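/- arXiv:math/0505115 — 10 statements merged into one kernel-verified Lean document; each statement's English description precedes it below -/
import Mathlib

section
/- The additive submonoid of ℤ^A generated by the vectors {e_ρ − e_{ρ+g_i} : ρ ∈ A, 1 ≤ i ≤ n} (the columns of the vertex–edge incidence matrix B of the McKay quiver) is equal to the subgroup 𝟙^⊥ = {θ ∈ ℤ^A : Σ_{ρ ∈ A} θ_ρ = 0}. In particular this submonoid is a subgroup of ℤ^A. -/
/-- If `g` generates the finite group `A`, every difference `e_a - e_b` of basis vectors is a sum of
incidence vectors of arrows: it is the telescoping sum along a path of arrows between `a` and `b`. -/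
theorem single_sub_single_mem_closure_incidence
    {A ι : Type*} [AddCommGroup A] [Finite A] [DecidableEq A] (g : ι → A)
    (hgen : AddSubgroup.closure (Set.range g) = ⊤) (a b : A) :
    (Pi.single a 1 - Pi.single b 1 : A → ℤ) ∈
      AddSubmonoid.closure {v : A → ℤ | ∃ (ρ : A) (i : ι),
        v = Pi.single ρ 1 - Pi.single (ρ + g i) 1} := by
  have hba : b - a ∈ AddSubmonoid.closure (Set.range g) := by
    rw [← AddSubgroup.closure_toAddSubmonoid_of_finite, hgen]
    trivial
  suffices h : ∀ c ∈ AddSubmonoid.closure (Set.range g), ∀ ρ : A,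
      (Pi.single ρ 1 - Pi.single (ρ + c) 1 : A → ℤ) ∈
        AddSubmonoid.closure {v : A → ℤ | ∃ (ρ : A) (i : ι),
          v = Pi.single ρ 1 - Pi.single (ρ + g i) 1} by
    simpa using h _ hba a
  intro c hc
  induction hc using AddSubmonoid.closure_induction with
  | mem c hc =>
    obtain ⟨i, rfl⟩ := hc
    exact fun ρ => AddSubmonoid.subset_closure ⟨ρ, i, rfl⟩
  | zero => simp
  | add c d _ _ hc hd =>
    intro ρ
    simpa [add_assoc] using add_mem (hc ρ) (hd (ρ + c))

/-- A submonoid of `ℤ^A` containing all differences of basis vectors contains every vector with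
coordinate sum zero. -/
theorem mem_of_sum_eq_zero_of_single_sub_single_mem
    {A : Type*} [Fintype A] [DecidableEq A] {M : AddSubmonoid (A → ℤ)}
    (hM : ∀ a b : A, (Pi.single a 1 - Pi.single b 1 : A → ℤ) ∈ M)
    {θ : A → ℤ} (hθ : ∑ ρ, θ ρ = 0) : θ ∈ M := by
  rcases isEmpty_or_nonempty A with _ | ⟨⟨o⟩⟩
  · rw [Subsingleton.elim θ 0]
    exact M.zero_mem
  have hsum : θ = ∑ ρ, θ ρ • (Pi.single ρ 1 - Pi.single o 1 : A → ℤ) := by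
    simp only [smul_sub, Finset.sum_sub_distrib, ← Finset.sum_smul, hθ, zero_smul, sub_zero]
    exact pi_eq_sum_univ' θ
  rw [hsum]
  refine sum_mem fun ρ _ => ?_
  obtain ⟨k, hk | hk⟩ := (θ ρ).eq_nat_or_neg
  · rw [hk, natCast_zsmul]
    exact nsmul_mem (hM ρ o) k
  · rw [hk, neg_smul, ← smul_neg, neg_sub, natCast_zsmul]
    exact nsmul_mem (hM o ρ) k

/-!
Statement 0: For a finite abelian group `A` (written additively) generated by
`g 1, …, g n`, the additive submonoid of `ℤ^A` generated by the vectors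
`e_ρ − e_{ρ + g i}` (the columns of the vertex–edge incidence matrix of the
McKay quiver) equals the subgroup `𝟙^⊥ = {θ ∈ ℤ^A : ∑_ρ θ_ρ = 0}`.
In particular, this submonoid is closed under negation, i.e. it is a subgroup.
-/
theorem mckay_incidence_submonoid_eq_sum_zero
    {A : Type*} [AddCommGroup A] [Fintype A] [DecidableEq A] {n : ℕ}
    (hn : 1 ≤ n) (g : Fin n → A)
    (hgen : AddSubgroup.closure (Set.range g) = ⊤) :
    (AddSubmonoid.closure {v : A → ℤ | ∃ (ρ : A) (i : Fin n),
        v = Pi.single ρ 1 - Pi.single (ρ + g i) 1} : Set (A → ℤ))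
      = {θ : A → ℤ | ∑ ρ : A, θ ρ = 0} ∧
    ∀ x ∈ AddSubmonoid.closure {v : A → ℤ | ∃ (ρ : A) (i : Fin n),
        v = Pi.single ρ 1 - Pi.single (ρ + g i) 1},
      -x ∈ AddSubmonoid.closure {v : A → ℤ | ∃ (ρ : A) (i : Fin n),
        v = Pi.single ρ 1 - Pi.single (ρ + g i) 1} := by
  have hcl : (AddSubmonoid.closure {v : A → ℤ | ∃ (ρ : A) (i : Fin n),
      v = Pi.single ρ 1 - Pi.single (ρ + g i) 1} : Set (A → ℤ))
      = {θ : A → ℤ | ∑ ρ : A, θ ρ = 0} := by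
    ext θ
    refine ⟨fun hθ => ?_, fun hθ => mem_of_sum_eq_zero_of_single_sub_single_mem
      (single_sub_single_mem_closure_incidence g hgen) hθ⟩
    rw [SetLike.mem_coe] at hθ
    rw [Set.mem_ofPred_eq]
    induction hθ using AddSubmonoid.closure_induction with
    | mem v hv =>
      obtain ⟨ρ, i, rfl⟩ := hv
      simp [Finset.sum_sub_distrib]
    | zero => simp
    | add x y _ _ hx hy => simp [Finset.sum_add_distrib, hx, hy]
  refine ⟨hcl, fun x hx => ?_⟩
  rw [← SetLike.mem_coe, hcl, Set.mem_ofPred_eq] at hx ⊢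
  simp [hx]
end

section
/- Let γ be a signed walk in the McKay quiver containing two consecutive steps whose arrows are labeled i and j, with i ≠ j. Then there exists a signed walk γ' with the same start vertex and end vertex as γ and the same number of steps, agreeing with γ in all steps other than these two consecutive steps, such that the two replacement steps of γ' are labeled j and i respectively (traversed with the same orientations, forward or backward, as the steps they replace), and such that v(γ) − v(γ') = ε·c_{i,j}^ρ for some ρ ∈ A and some ε ∈ {+1, −1}. -/
/-!
Statement 2: If a signed walk `γ` in the McKay quiver has two consecutive steps
labeled `i` and `j` with `i ≠ j`, then there is a signed walk `γ'` with the same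
start and end vertices and the same number of steps, agreeing with `γ` except in
these two consecutive steps, whose replacement steps are labeled `j` and `i`
respectively (each traversed with the same orientation as the step of that label
it replaces), and such that `v(γ) − v(γ') = ± c_{i,j}^ρ` for some `ρ ∈ A`.
-/

/-- A step of a signed walk in the McKay quiver: an arrow `a_i^ρ` together with a
direction of traversal (`true` = forward, from `ρ + g i` to `ρ`). -/
abbrev McKayStep (A : Type*) (n : ℕ) := A × Fin n × Bool

/-- The start vertex of a step. -/
def mckayStepStart {A : Type*} [AddCommGroup A] {n : ℕ} (g : Fin n → A)
    (s : McKayStep A n) : A :=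
  if s.2.2 then s.1 + g s.2.1 else s.1

/-- The end vertex of a step. -/
def mckayStepEnd {A : Type*} [AddCommGroup A] {n : ℕ} (g : Fin n → A)
    (s : McKayStep A n) : A :=
  if s.2.2 then s.1 else s.1 + g s.2.1

/-- A list of steps is a signed walk when consecutive steps match up. -/
def IsMcKayWalk {A : Type*} [AddCommGroup A] {n : ℕ} (g : Fin n → A)
    (l : List (McKayStep A n)) : Prop :=
  l.Chain' (fun a b => mckayStepEnd g a = mckayStepStart g b)

/-- The vector of a signed walk: the `(ρ,i)`-entry is the number of forward
traversals of `a_i^ρ` minus the number of backward traversals. -/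
def mckayWalkVec {A : Type*} [DecidableEq A] {n : ℕ}
    (l : List (McKayStep A n)) : A × Fin n → ℤ :=
  fun p => (l.count (p.1, p.2, true) : ℤ) - (l.count (p.1, p.2, false) : ℤ)

theorem mckayWalkVec_append {A : Type*} [DecidableEq A] {n : ℕ} (l l' : List (McKayStep A n)) :
    mckayWalkVec (l ++ l') = mckayWalkVec l + mckayWalkVec l' := by
  funext p
  simp only [mckayWalkVec, List.count_append, Pi.add_apply]
  push_cast
  ring

theorem mckayWalkVec_cons {A : Type*} [DecidableEq A] {n : ℕ} (ρ : A) (i : Fin n) (d : Bool)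
    (l : List (McKayStep A n)) :
    mckayWalkVec ((ρ, i, d) :: l)
      = (if d then 1 else -1 : ℤ) • (Pi.single (ρ, i) 1 : A × Fin n → ℤ) + mckayWalkVec l := by
  funext ⟨σ, k⟩
  by_cases h : σ = ρ ∧ k = i
  · obtain ⟨rfl, rfl⟩ := h
    cases d <;> simp [mckayWalkVec] <;> ring
  · have h' : ¬(ρ = σ ∧ i = k) := fun h' => h ⟨h'.1.symm, h'.2.symm⟩
    cases d <;> simp_all [mckayWalkVec]

/-- Two consecutive steps of a walk may be replaced by any two composable steps with the same
start and end. -/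
theorem IsMcKayWalk.replace_two {A : Type*} [AddCommGroup A] {n : ℕ} {g : Fin n → A}
    {l₁ l₂ : List (McKayStep A n)} {s t s' t' : McKayStep A n}
    (h : IsMcKayWalk g (l₁ ++ s :: t :: l₂))
    (hs : mckayStepStart g s' = mckayStepStart g s) (ht : mckayStepEnd g t' = mckayStepEnd g t)
    (hst : mckayStepEnd g s' = mckayStepStart g t') :
    IsMcKayWalk g (l₁ ++ s' :: t' :: l₂) := by
  obtain ⟨hl₁, h, hl₁s⟩ := List.isChain_append.1 h
  obtain ⟨htl₂, hl₂⟩ := List.isChain_cons.1 (List.isChain_cons_cons.1 h).2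
  refine List.isChain_append.2 ⟨hl₁, List.isChain_cons_cons.2
    ⟨hst, List.isChain_cons.2 ⟨fun y hy => ht.trans (htl₂ y hy), hl₂⟩⟩, fun x hx y hy => ?_⟩
  obtain rfl : s' = y := by simpa using hy
  exact (hl₁s x hx s (by simp)).trans hs.symm

theorem head?_map_append_cons_congr {α β : Type*} (f : α → β) {s s' : α} (h : f s' = f s)
    (l m m' : List α) :
    (l ++ s' :: m').head?.map f = (l ++ s :: m).head?.map f := by
  cases l <;> simp [h]

theorem getLast?_map_append_cons_congr {α β : Type*} (f : α → β) {t t' : α} (h : f t' = f t)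
    (l l' m : List α) :
    (l' ++ t' :: m).getLast?.map f = (l ++ t :: m).getLast?.map f := by
  cases m using List.reverseRecOn <;> simp [List.getLast?_append, List.getLast?_cons, h]

/-- Two consecutive steps labeled `i` and `j` can be exchanged for steps labeled `j` and `i` with
the same orientations, start and end. -/
theorem exists_mckayStep_swap {A : Type*} [AddCommGroup A] [DecidableEq A] {n : ℕ} (g : Fin n → A)
    (i j : Fin n) (ρ₁ ρ₂ : A) (d₁ d₂ : Bool)
    (h : mckayStepEnd g (ρ₁, i, d₁) = mckayStepStart g (ρ₂, j, d₂)) :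
    ∃ (σ₁ σ₂ ρ : A) (ε : ℤ), (ε = 1 ∨ ε = -1) ∧
      mckayStepStart g (σ₁, j, d₂) = mckayStepStart g (ρ₁, i, d₁) ∧
      mckayStepEnd g (σ₂, i, d₁) = mckayStepEnd g (ρ₂, j, d₂) ∧
      mckayStepEnd g (σ₁, j, d₂) = mckayStepStart g (σ₂, i, d₁) ∧
      mckayWalkVec [(ρ₁, i, d₁), (ρ₂, j, d₂)] - mckayWalkVec [(σ₁, j, d₂), (σ₂, i, d₁)]
        = ε • (Pi.single (ρ, i) 1 + Pi.single (ρ + g i, j) 1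
            - Pi.single (ρ, j) 1 - Pi.single (ρ + g j, i) 1 : A × Fin n → ℤ) := by
  simp only [mckayWalkVec_cons]
  cases d₁ <;> cases d₂ <;>
    simp only [mckayStepStart, mckayStepEnd, if_true, Bool.false_eq_true, if_false] at h ⊢
  · subst h
    exact ⟨ρ₁, ρ₁ + g j, ρ₁, -1, Or.inr rfl, rfl, by abel, rfl, by module⟩
  · obtain rfl : ρ₁ = ρ₂ + g j - g i := eq_sub_of_add_eq h
    refine ⟨ρ₂ - g i, ρ₂ - g i, ρ₂ - g i, 1, Or.inl rfl, by abel, by abel, rfl, ?_⟩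
    rw [sub_add_cancel, add_sub_right_comm ρ₂]
    module
  · subst h
    exact ⟨ρ₁ + g i, ρ₁ + g j, ρ₁, 1, Or.inl rfl, rfl, rfl, by abel, by module⟩
  · subst h
    exact ⟨ρ₂ + g i, ρ₂, ρ₂, -1, Or.inr rfl, by abel, rfl, rfl, by module⟩

theorem mckay_switch_adjacent_labels
    {A : Type*} [AddCommGroup A] [Fintype A] [DecidableEq A] {n : ℕ}
    (hn : 1 ≤ n) (g : Fin n → A)
    (hgen : AddSubgroup.closure (Set.range g) = ⊤)
    (i j : Fin n) (hij : i ≠ j)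
    (l₁ l₂ : List (McKayStep A n)) (ρ₁ ρ₂ : A) (d₁ d₂ : Bool)
    (hwalk : IsMcKayWalk g (l₁ ++ (ρ₁, i, d₁) :: (ρ₂, j, d₂) :: l₂)) :
    ∃ (σ₁ σ₂ ρ : A) (ε : ℤ), (ε = 1 ∨ ε = -1) ∧
      IsMcKayWalk g (l₁ ++ (σ₁, j, d₂) :: (σ₂, i, d₁) :: l₂) ∧
      ((l₁ ++ (σ₁, j, d₂) :: (σ₂, i, d₁) :: l₂).head?.map (mckayStepStart g)
        = (l₁ ++ (ρ₁, i, d₁) :: (ρ₂, j, d₂) :: l₂).head?.map (mckayStepStart g)) ∧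
      ((l₁ ++ (σ₁, j, d₂) :: (σ₂, i, d₁) :: l₂).getLast?.map (mckayStepEnd g)
        = (l₁ ++ (ρ₁, i, d₁) :: (ρ₂, j, d₂) :: l₂).getLast?.map (mckayStepEnd g)) ∧
      mckayWalkVec (l₁ ++ (ρ₁, i, d₁) :: (ρ₂, j, d₂) :: l₂)
          - mckayWalkVec (l₁ ++ (σ₁, j, d₂) :: (σ₂, i, d₁) :: l₂)
        = ε • (Pi.single (ρ, i) 1 + Pi.single (ρ + g i, j) 1
            - Pi.single (ρ, j) 1 - Pi.single (ρ + g j, i) 1 : A × Fin n → ℤ) := by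
  have h : mckayStepEnd g (ρ₁, i, d₁) = mckayStepStart g (ρ₂, j, d₂) :=
    (List.isChain_cons_cons.1 (List.isChain_append.1 hwalk).2.1).1
  obtain ⟨σ₁, σ₂, ρ, ε, hε, hs, ht, hst, hv⟩ := exists_mckayStep_swap g i j ρ₁ ρ₂ d₁ d₂ h
  refine ⟨σ₁, σ₂, ρ, ε, hε, hwalk.replace_two hs ht hst,
    head?_map_append_cons_congr _ hs _ _ _, ?_, ?_⟩
  · simpa using getLast?_map_append_cons_congr _ ht
      (l₁ ++ [(ρ₁, i, d₁)]) (l₁ ++ [(σ₁, j, d₂)]) l₂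
  · rw [← hv]
    simp only [mckayWalkVec_append, mckayWalkVec_cons]
    abel
end

section
/- The kernel of the ℤ-linear map C : ℤ^{A×n} → ℤ^A × ℤ^n is equal to the ℤ-submodule of ℤ^{A×n} spanned by the set {c_{i,j}^ρ : ρ ∈ A, 1 ≤ i, j ≤ n, i ≠ j}. -/
/-- Let `x : A → ι → Q` be a labelling of the arrows of the Cayley graph of `A` for which the
elementary squares commute. Then `x` extends to a `1`-cocycle on `ι → ℤ`. -/
theorem exists_cocycle_of_squares {A Q ι : Type*} [AddCommGroup A] [AddCommGroup Q] [Fintype ι]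
    [DecidableEq ι] (g : ι → A) (x : A → ι → Q)
    (hx : ∀ ρ i j, x ρ i + x (ρ + g i) j = x ρ j + x (ρ + g j) i) :
    ∃ z : (ι → ℤ) → A → Q,
      (∀ v w ρ, z (v + w) ρ = z v ρ + z w (ρ + Fintype.linearCombination ℤ g v)) ∧
      ∀ i ρ, z (Pi.single i 1) ρ = x ρ i := by
  let T (i : ι) : (A → Multiplicative Q) ⋊[mulAutArrow] Multiplicative A :=
    ⟨fun ρ => .ofAdd (x ρ i), .ofAdd (-g i)⟩
  have hT (i j : ι) : Commute (T i) (T j) := by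
    refine SemidirectProduct.ext (funext fun ρ => ?_) (mul_comm _ _)
    change x ρ i + x (- -g i + ρ) j = x ρ j + x (- -g j + ρ) i
    simpa [add_comm] using hx ρ i j
  let F : (ι → Multiplicative ℤ) →* (A → Multiplicative Q) ⋊[mulAutArrow] Multiplicative A :=
    MonoidHom.noncommPiCoprod (fun i => zpowersHom _ (T i))
      fun i j _ a b => (hT i j).zpow_zpow _ _
  have hF (i : ι) : F (Pi.mulSingle i (.ofAdd 1)) = T i :=
    (MonoidHom.noncommPiCoprod_mulSingle _ i _).trans (by simp)
  have hright (v : ι → ℤ) :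
      (F fun i => .ofAdd (v i)).right = .ofAdd (-Fintype.linearCombination ℤ g v) := by
    let R : (ι → ℤ) →+ A :=
      { toFun := fun v => (F fun i => .ofAdd (v i)).right.toAdd
        map_zero' := congrArg (fun t => t.right.toAdd) (map_one F)
        map_add' := fun v w => congrArg (fun t => t.right.toAdd)
          (map_mul F (fun i => .ofAdd (v i)) fun i => .ofAdd (w i)) }
    have hR : R = -(Fintype.linearCombination ℤ g).toAddMonoidHom := by
      ext i
      have h : R (Pi.single i 1) = -g i := congrArg (fun t => t.right.toAdd) (hF i)
      simpa using h
    exact DFunLike.congr_fun hR v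
  refine ⟨fun v ρ => ((F fun i => .ofAdd (v i)).left ρ).toAdd, fun v w ρ => ?_, fun i ρ => ?_⟩
  · have h := congrArg (fun t => (t.left ρ).toAdd)
      (map_mul F (fun i => .ofAdd (v i)) fun i => .ofAdd (w i))
    refine h.trans ?_
    rw [SemidirectProduct.mul_left, hright]
    change _ + ((F fun i => .ofAdd (w i)).left (- -Fintype.linearCombination ℤ g v + ρ)).toAdd = _
    rw [neg_neg, add_comm _ ρ]
  · exact congrArg (fun t => (t.left ρ).toAdd) (hF i)

/-- A closed chain of arrows in the Cayley graph of `A` pairs to zero with every potential. -/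
theorem sum_smul_sub_eq_zero {A V ι : Type*} [AddCommGroup A] [Fintype A] [DecidableEq A]
    [AddCommGroup V] [Fintype ι] (g : ι → A) (u : A × ι → ℤ)
    (hA : ∑ p, u p • (Pi.single p.1 1 - Pi.single (p.1 + g p.2) 1 : A → ℤ) = 0) (P : A → V) :
    ∑ p, u p • (P p.1 - P (p.1 + g p.2)) = 0 := by
  have h := congrArg (Fintype.linearCombination ℤ P) hA
  simpa only [map_sum, map_smul, map_sub, map_zero, Fintype.linearCombination_apply_single,
    one_smul] using h

/-- If the elementary squares commute for the labelling `x`, then every relation among the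
vectors `(e_ρ - e_{ρ + g i}, e_i)` also holds among the `x ρ i`. -/
theorem linearCombination_eq_zero_of_squares {A Q ι : Type*} [AddCommGroup A] [Fintype A]
    [DecidableEq A] [AddCommGroup Q] [Fintype ι] [DecidableEq ι] (g : ι → A)
    (hgen : AddSubgroup.closure (Set.range g) = ⊤) (x : A → ι → Q)
    (hx : ∀ ρ i j, x ρ i + x (ρ + g i) j = x ρ j + x (ρ + g j) i) (u : A × ι → ℤ)
    (hA : ∑ p, u p • (Pi.single p.1 1 - Pi.single (p.1 + g p.2) 1 : A → ℤ) = 0)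
    (hι : ∑ p, u p • (Pi.single p.2 1 : ι → ℤ) = 0) :
    ∑ p, u p • x p.1 p.2 = 0 := by
  obtain ⟨z, hz, hzx⟩ := exists_cocycle_of_squares g x hx
  set π := Fintype.linearCombination ℤ g
  have hπ (a : A) : ∃ v, π v = a := by
    have : AddSubgroup.closure (Set.range g) ≤ π.toAddMonoidHom.range := by
      rw [AddSubgroup.closure_le]
      rintro _ ⟨i, rfl⟩
      exact ⟨Pi.single i 1, by simp [π]⟩
    exact this (hgen ▸ AddSubgroup.mem_top a)
  choose s hs using hπ
  let zL : π.toAddMonoidHom.ker →+ Q := AddMonoidHom.mk' (fun v => z v 0) fun v w => by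
    have hv : π v = 0 := v.2
    simp [hz, hv]
  let l (p : A × ι) : π.toAddMonoidHom.ker :=
    ⟨s p.1 + Pi.single p.2 1 - s (p.1 + g p.2), by simp [AddMonoidHom.mem_ker, hs, π]⟩
  have hl : ∑ p, u p • l p = 0 := by
    apply Subtype.ext
    simp only [AddSubgroup.val_finsetSum, AddSubgroup.coe_zsmul, l, add_sub_right_comm, smul_add,
      Finset.sum_add_distrib, hι, sum_smul_sub_eq_zero g u hA s, add_zero, ZeroMemClass.coe_zero]
  have hxl (p : A × ι) : x p.1 p.2 = zL (l p) - (z (s p.1) 0 - z (s (p.1 + g p.2)) 0) := by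
    have h₁ := hz (s p.1) (Pi.single p.2 1) 0
    have h₂ := hz (l p) (s (p.1 + g p.2)) 0
    have hlp : π (l p) = 0 := (l p).2
    have h₃ : (l p : ι → ℤ) + s (p.1 + g p.2) = s p.1 + Pi.single p.2 1 := sub_add_cancel _ _
    rw [h₃, h₁, hs, hzx, hlp, zero_add, zero_add] at h₂
    change _ = z (l p) 0 - _
    rw [sub_sub_eq_add_sub, ← h₂, add_sub_cancel_left]
  have hz0 := congrArg zL hl
  simp only [map_sum, map_zsmul, map_zero] at hz0
  simp only [hxl, smul_sub (u _) (zL _), Finset.sum_sub_distrib, hz0,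
    sum_smul_sub_eq_zero g u hA fun a => z (s a) 0, sub_zero]

/-!
Statement 3: The kernel of the ℤ-linear map `C : ℤ^{A×n} → ℤ^A × ℤ^n`, sending
the basis vector `e_i^ρ` to `(e_ρ − e_{ρ + g i}, e_i)`, is the ℤ-submodule of
`ℤ^{A×n}` spanned by the vectors
`c_{i,j}^ρ = e_i^ρ + e_j^{ρ+g i} − e_j^ρ − e_i^{ρ+g j}` for `ρ ∈ A`, `i ≠ j`.
-/
theorem mckay_ker_C_eq_span_c
    {A : Type*} [AddCommGroup A] [Fintype A] [DecidableEq A] {n : ℕ}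
    (hn : 1 ≤ n) (g : Fin n → A)
    (hgen : AddSubgroup.closure (Set.range g) = ⊤) :
    {u : A × Fin n → ℤ |
        (∑ p : A × Fin n, u p •
          ((Pi.single p.1 (1 : ℤ) - Pi.single (p.1 + g p.2) 1 : A → ℤ),
           (Pi.single p.2 (1 : ℤ) : Fin n → ℤ))) = 0}
      = (Submodule.span ℤ
          {c : A × Fin n → ℤ | ∃ (ρ : A) (i j : Fin n), i ≠ j ∧
            c = Pi.single (ρ, i) 1 + Pi.single (ρ + g i, j) 1
                - Pi.single (ρ, j) 1 - Pi.single (ρ + g j, i) 1} :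
          Set (A × Fin n → ℤ)) := by
  ext u
  simp only [Set.mem_ofPred_eq, SetLike.mem_coe]
  set S := Submodule.span ℤ
    {c : A × Fin n → ℤ | ∃ (ρ : A) (i j : Fin n), i ≠ j ∧
      c = Pi.single (ρ, i) 1 + Pi.single (ρ + g i, j) 1
          - Pi.single (ρ, j) 1 - Pi.single (ρ + g j, i) 1} with hS
  constructor
  · intro hu
    have hx (ρ : A) (i j : Fin n) :
        S.mkQ (Pi.single (ρ, i) 1) + S.mkQ (Pi.single (ρ + g i, j) 1) =
          S.mkQ (Pi.single (ρ, j) 1) + S.mkQ (Pi.single (ρ + g j, i) 1) := by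
      obtain rfl | hij := eq_or_ne i j
      · rfl
      · rw [← sub_eq_zero, ← sub_sub, ← map_add, ← map_sub, ← map_sub, Submodule.mkQ_apply,
          Submodule.Quotient.mk_eq_zero]
        exact Submodule.subset_span ⟨ρ, i, j, hij, rfl⟩
    have h := linearCombination_eq_zero_of_squares g hgen
      (fun ρ i => S.mkQ (Pi.single (ρ, i) 1)) hx u
      (by simpa [Prod.fst_sum] using congrArg Prod.fst hu)
      (by simpa [Prod.snd_sum] using congrArg Prod.snd hu)
    rw [← Submodule.Quotient.mk_eq_zero S, ← Submodule.mkQ_apply, pi_eq_sum_univ' u]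
    simpa only [map_sum, map_smul] using h
  · intro hu
    let C := Fintype.linearCombination ℤ fun p : A × Fin n =>
      ((Pi.single p.1 (1 : ℤ) - Pi.single (p.1 + g p.2) 1 : A → ℤ),
        (Pi.single p.2 (1 : ℤ) : Fin n → ℤ))
    suffices h : S ≤ LinearMap.ker C from h hu
    rw [hS, Submodule.span_le]
    rintro _ ⟨ρ, i, j, -, rfl⟩
    simp only [SetLike.mem_coe, LinearMap.mem_ker, C, map_sub, map_add,
      Fintype.linearCombination_apply_single, one_smul, add_right_comm ρ (g j)]
    ext <;> simp
end

section
/- The toric ideal I_C is equal to the saturation of I with respect to the product of all the variables; that is, I_C = { f ∈ k[z_i^ρ : ρ ∈ A, 1 ≤ i ≤ n] : there exists m ∈ ℕ with (∏_{ρ ∈ A, 1 ≤ i ≤ n} z_i^ρ)^m · f ∈ I }. -/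
open MvPolynomial

/-- Translation action of an abelian group on the functions defined on it. -/
def translationMulAut (A M : Type*) [AddCommGroup A] [AddCommGroup M] :
    Multiplicative A →* MulAut (Multiplicative (A → M)) where
  toFun a :=
    { toFun := fun f => .ofAdd fun ρ => f.toAdd (ρ + a.toAdd)
      invFun := fun f => .ofAdd fun ρ => f.toAdd (ρ - a.toAdd)
      left_inv := fun f => by simp
      right_inv := fun f => by simp
      map_mul' := fun _ _ => rfl }
  map_one' := by ext f; simp
  map_mul' a b := by
    refine MulEquiv.ext fun f => ?_
    apply Multiplicative.toAdd.injective
    funext ρ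
    change f.toAdd (ρ + (a.toAdd + b.toAdd)) = f.toAdd (ρ + a.toAdd + b.toAdd)
    rw [add_assoc]

/-- A labelling of the edges of the Cayley graph of `(A, g)` which sums to zero around every
commutation square integrates to a path sum on `ι → ℤ`. -/
theorem exists_pathSum {A ι M : Type*} [AddCommGroup A] [Fintype ι] [DecidableEq ι]
    [AddCommGroup M] (g : ι → A) (F : A → ι → M)
    (hF : ∀ ρ i j, F (ρ + g i) j + F ρ i = F (ρ + g j) i + F ρ j) :
    ∃ Q : (ι → ℤ) → A → M,
      (∀ w v ρ, Q (w + v) ρ = Q w ρ + Q v (ρ + ∑ i, w i • g i)) ∧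
      ∀ i ρ, Q (Pi.single i 1) ρ = F ρ i := by
  let t : ι → Multiplicative (A → M) ⋊[translationMulAut A M] Multiplicative A :=
    fun i => ⟨.ofAdd fun ρ => F ρ i, .ofAdd (g i)⟩
  have ht : Pairwise fun i j =>
      ∀ x y, Commute (zpowersHom _ (t i) x) (zpowersHom _ (t j) y) := by
    intro i j _ x y
    have h : Commute (t i) (t j) := by
      refine SemidirectProduct.ext ?_ ?_
      · apply Multiplicative.toAdd.injective
        funext ρ
        change F ρ i + F (ρ + g i) j = F ρ j + F (ρ + g j) i
        rw [add_comm, hF, add_comm]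
      · exact mul_comm (Multiplicative.ofAdd (g i)) _
    simpa only [zpowersHom_apply] using h.zpow_zpow _ _
  let T := MonoidHom.noncommPiCoprod (fun i => zpowersHom _ (t i)) ht
  have hT : ∀ i, T (Pi.mulSingle i (.ofAdd 1)) = t i := fun i => by
    simp [T, MonoidHom.noncommPiCoprod_mulSingle]
  have hright : ∀ w : ι → ℤ, (T fun i => .ofAdd (w i)).right.toAdd = ∑ i, w i • g i := by
    intro w
    have h : (SemidirectProduct.rightHom.comp T) (fun i => .ofAdd (w i)) =
        ∏ i, (.ofAdd (g i) : Multiplicative A) ^ w i := by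
      rw [← Finset.univ_prod_mulSingle (fun i => Multiplicative.ofAdd (w i)), map_prod]
      refine Finset.prod_congr rfl fun i _ => ?_
      rw [MonoidHom.comp_apply, MonoidHom.noncommPiCoprod_mulSingle, zpowersHom_apply, map_zpow]
      rfl
    change Multiplicative.toAdd ((SemidirectProduct.rightHom.comp T) _) = _
    rw [h, toAdd_prod]
    rfl
  refine ⟨fun w ρ => (T fun i => .ofAdd (w i)).left.toAdd ρ, fun w v ρ => ?_, fun i ρ => ?_⟩
  · have h : (fun i => Multiplicative.ofAdd ((w + v) i)) =
        (fun i => .ofAdd (w i)) * fun i => .ofAdd (v i) := rfl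
    beta_reduce
    rw [h, map_mul, SemidirectProduct.mul_left, ← hright]
    rfl
  · have h : (fun j => Multiplicative.ofAdd ((Pi.single i 1 : ι → ℤ) j)) =
        Pi.mulSingle i (.ofAdd 1) := rfl
    simp only [h, hT]
    rfl

/-- The boundary of the edge `p` in the Cayley graph of `(A, g)`, together with its label. -/
def labelledBoundary {A ι : Type*} [Add A] [DecidableEq A] [DecidableEq ι] (g : ι → A)
    (p : A × ι) : (A → ℤ) × (ι → ℤ) :=
  (Pi.single p.1 1 - Pi.single (p.1 + g p.2) 1, Pi.single p.2 1)

theorem labelledBoundary_add_comm {A ι : Type*} [AddCommGroup A] [DecidableEq A] [DecidableEq ι]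
    (g : ι → A) (ρ : A) (i j : ι) :
    labelledBoundary g (ρ + g i, j) + labelledBoundary g (ρ, i) =
      labelledBoundary g (ρ + g j, i) + labelledBoundary g (ρ, j) := by
  simp only [labelledBoundary, Prod.mk_add_mk, add_right_comm ρ (g j) (g i), Prod.mk.injEq]
  exact ⟨by abel, add_comm _ _⟩

/-- If `g` generates `A`, every integral relation between labelled boundaries also holds for
edge labellings which sum to zero around every commutation square. -/
theorem sum_zsmul_eq_zero_of_sum_zsmul_labelledBoundary_eq_zero {A ι M : Type*} [AddCommGroup A]
    [Fintype A] [DecidableEq A] [Fintype ι] [DecidableEq ι] [AddCommGroup M] {g : ι → A}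
    (hgen : AddSubgroup.closure (Set.range g) = ⊤) {F : A → ι → M}
    (hF : ∀ ρ i j, F (ρ + g i) j + F ρ i = F (ρ + g j) i + F ρ j)
    {u : A × ι → ℤ} (hu : ∑ p, u p • labelledBoundary g p = 0) :
    ∑ p, u p • F p.1 p.2 = 0 := by
  obtain ⟨Q, hQ, hQF⟩ := exists_pathSum g F hF
  let π : (ι → ℤ) →ₗ[ℤ] A := Fintype.linearCombination ℤ g
  have hπ : ∀ v, π v = ∑ i, v i • g i := fun v => Fintype.linearCombination_apply ℤ g v
  have hsurj : Function.Surjective π := by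
    rw [← LinearMap.range_eq_top, Fintype.range_linearCombination,
      ← Submodule.toAddSubgroup_inj, Submodule.span_int_eq_addSubgroupClosure, hgen]
    rfl
  choose w hw using hsurj
  let P : LinearMap.ker π →ₗ[ℤ] M := AddMonoidHom.toIntLinearMap <|
    AddMonoidHom.mk' (fun v => Q v 0) fun v v' => by
      have hv : ∑ i, (v : ι → ℤ) i • g i = 0 := by rw [← hπ]; exact v.2
      simp [hQ, hv]
  let W : (A → ℤ) × (ι → ℤ) →ₗ[ℤ] (ι → ℤ) :=
    (Fintype.linearCombination ℤ w).coprod LinearMap.id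
  let S : (A → ℤ) × (ι → ℤ) →ₗ[ℤ] M :=
    (Fintype.linearCombination ℤ fun ρ => Q (w ρ) 0).comp (LinearMap.fst ℤ _ _)
  have hW : ∀ p, W (labelledBoundary g p) = w p.1 - w (p.1 + g p.2) + Pi.single p.2 1 := by
    intro p
    simp [W, labelledBoundary]
  have hS : ∀ p, S (labelledBoundary g p) = Q (w p.1) 0 - Q (w (p.1 + g p.2)) 0 := by
    intro p
    simp [S, labelledBoundary]
  have hker : ∀ p, W (labelledBoundary g p) ∈ LinearMap.ker π := by
    intro p
    rw [hW, LinearMap.mem_ker, map_add, map_sub, hw, hw]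
    simp [π]
  have hFP : ∀ p, F p.1 p.2 = P ⟨_, hker p⟩ - S (labelledBoundary g p) := by
    intro p
    have h1 : Q (w p.1 + Pi.single p.2 1) 0 = Q (w p.1) 0 + F p.1 p.2 := by
      rw [hQ, hQF, ← hπ, hw, zero_add]
    have h2 : Q (W (labelledBoundary g p) + w (p.1 + g p.2)) 0 =
        Q (W (labelledBoundary g p)) 0 + Q (w (p.1 + g p.2)) 0 := by
      rw [hQ, ← hπ, hker p, zero_add]
    have h3 : W (labelledBoundary g p) + w (p.1 + g p.2) = w p.1 + Pi.single p.2 1 := by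
      rw [hW]
      abel
    rw [h3, h1] at h2
    change _ = Q (W (labelledBoundary g p)) 0 - _
    rw [hS, eq_sub_iff_add_eq, ← sub_eq_zero]
    rw [← sub_eq_zero] at h2
    rw [← h2]
    abel
  have hP : ∑ p, u p • (⟨_, hker p⟩ : LinearMap.ker π) = 0 := by
    apply Subtype.ext
    have h := congrArg W hu
    simpa only [map_sum, map_smul, map_zero, AddSubmonoidClass.coe_finsetSum,
      SetLike.val_smul, ZeroMemClass.coe_zero] using h
  calc ∑ p, u p • F p.1 p.2
      = P (∑ p, u p • ⟨_, hker p⟩) - S (∑ p, u p • labelledBoundary g p) := by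
        simp only [hFP, smul_sub, Finset.sum_sub_distrib, map_sum, map_smul]
    _ = 0 := by rw [hP, hu, map_zero, map_zero, sub_zero]

/-- The algebra map sending each variable to the group-ring monomial prescribed by `c`. -/
noncomputable def toricMap {σ B : Type*} (k : Type*) [AddCommGroup B] [CommRing k] (c : σ → B) :
    MvPolynomial σ k →ₐ[k] AddMonoidAlgebra k B :=
  aeval fun p => AddMonoidAlgebra.single (c p) 1

theorem toricMap_monomial {σ B k : Type*} [Fintype σ] [AddCommGroup B] [CommRing k] (c : σ → B)
    (u : σ →₀ ℕ) (a : k) :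
    toricMap k c (monomial u a) = AddMonoidAlgebra.single (∑ p, (u p : ℤ) • c p) a := by
  rw [toricMap, aeval_monomial, Finsupp.prod_fintype _ _ fun _ => pow_zero _]
  have h : ∏ p, (AddMonoidAlgebra.single (c p) (1 : k)) ^ u p =
      AddMonoidAlgebra.single (∑ p, (u p : ℤ) • c p) 1 := by
    have h1 := map_prod (AddMonoidAlgebra.of k B)
      (fun p => (Multiplicative.ofAdd (c p)) ^ u p) Finset.univ
    simp only [map_pow, AddMonoidAlgebra.of_apply, toAdd_prod, toAdd_pow, toAdd_ofAdd] at h1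
    simpa only [natCast_zsmul] using h1.symm
  rw [h]
  simp

/-- The kernel of a toric map is generated by the binomials it contains. -/
theorem ker_toricMap {σ B k : Type*} [Fintype σ] [AddCommGroup B] [CommRing k] (c : σ → B) :
    RingHom.ker (toricMap k c) =
      Ideal.span {f : MvPolynomial σ k | ∃ u v : σ →₀ ℕ,
        ∑ p, (u p : ℤ) • c p = ∑ p, (v p : ℤ) • c p ∧
          f = monomial u 1 - monomial v 1} := by
  apply le_antisymm
  · intro f hf
    set J := Ideal.span {f : MvPolynomial σ k | ∃ u v : σ →₀ ℕ,
        ∑ p, (u p : ℤ) • c p = ∑ p, (v p : ℤ) • c p ∧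
          f = monomial u 1 - monomial v 1}
    let e : (σ →₀ ℕ) → B := fun u => ∑ p, (u p : ℤ) • c p
    let s : B → (σ →₀ ℕ) := Function.invFun e
    let Ψ : AddMonoidAlgebra k B →ₗ[k] MvPolynomial σ k ⧸ J :=
      (Finsupp.linearCombination k fun b => Ideal.Quotient.mkₐ k J (monomial (s b) 1)).comp
        (AddMonoidAlgebra.coeffLinearEquiv k).toLinearMap
    have hΨ : Ψ.comp (toricMap k c).toLinearMap = (Ideal.Quotient.mkₐ k J).toLinearMap := by
      refine MvPolynomial.linearMap_ext fun u => LinearMap.ext_ring ?_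
      have hs : e (s (e u)) = e u := Function.invFun_eq ⟨u, rfl⟩
      have hmem : (monomial (s (e u)) 1 - monomial u 1 : MvPolynomial σ k) ∈ J :=
        Ideal.subset_span ⟨_, _, hs, rfl⟩
      have hq := Ideal.Quotient.eq.2 hmem
      have hu : toricMap k c (monomial u 1) = AddMonoidAlgebra.single (e u) 1 :=
        toricMap_monomial c u 1
      simpa [Ψ, hu] using hq
    rw [← Ideal.Quotient.eq_zero_iff_mem]
    have h := LinearMap.congr_fun hΨ f
    rw [LinearMap.comp_apply, AlgHom.toLinearMap_apply, RingHom.mem_ker.1 hf, map_zero] at h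
    exact h.symm
  · rw [Ideal.span_le]
    rintro _ ⟨u, v, h, rfl⟩
    rw [SetLike.mem_coe, RingHom.mem_ker, map_sub, toricMap_monomial,
      toricMap_monomial, h, sub_self]

/-- The kernel of the map to the localization of `R ⧸ I` away from `x` is the saturation of `I`
with respect to `x`. -/
theorem algebraMap_mk_eq_zero_iff_exists_pow_mul_mem {R : Type*} [CommRing R] (I : Ideal R)
    (x f : R) :
    algebraMap (R ⧸ I) (Localization.Away (Ideal.Quotient.mk I x)) (Ideal.Quotient.mk I f) = 0 ↔
      ∃ m : ℕ, x ^ m * f ∈ I := by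
  rw [IsLocalization.map_eq_zero_iff (Submonoid.powers (Ideal.Quotient.mk I x))]
  simp only [Subtype.exists, Submonoid.mem_powers_iff, exists_prop, exists_exists_eq_and,
    ← map_pow, ← map_mul, Ideal.Quotient.eq_zero_iff_mem]

/-- The toric ideal of the labelled boundary map is the saturation, with respect to the product of
all variables, of the ideal of commutation relations. -/
theorem mckay_toric_ideal_eq_saturation
    {A : Type*} [AddCommGroup A] [Fintype A] [DecidableEq A] {n : ℕ}
    (hn : 1 ≤ n) (g : Fin n → A)
    (hgen : AddSubgroup.closure (Set.range g) = ⊤)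
    (k : Type*) [Field k] [IsAlgClosed k]
    (hchar : ¬ (ringChar k ∣ Fintype.card A)) :
    ((Ideal.span {f : MvPolynomial (A × Fin n) k |
        ∃ (u v : (A × Fin n) →₀ ℕ),
          (∑ p : A × Fin n, (u p : ℤ) •
              ((Pi.single p.1 (1 : ℤ) - Pi.single (p.1 + g p.2) 1 : A → ℤ),
               (Pi.single p.2 (1 : ℤ) : Fin n → ℤ)))
            = (∑ p : A × Fin n, (v p : ℤ) •
              ((Pi.single p.1 (1 : ℤ) - Pi.single (p.1 + g p.2) 1 : A → ℤ),
               (Pi.single p.2 (1 : ℤ) : Fin n → ℤ))) ∧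
          f = monomial u 1 - monomial v 1}) : Set (MvPolynomial (A × Fin n) k))
      = {f : MvPolynomial (A × Fin n) k | ∃ m : ℕ,
          (∏ p : A × Fin n, X p) ^ m * f ∈
            Ideal.span {f : MvPolynomial (A × Fin n) k |
              ∃ (ρ : A) (i j : Fin n),
                f = X (ρ + g i, j) * X (ρ, i) - X (ρ + g j, i) * X (ρ, j)}} := by
  have hspan := ker_toricMap (k := k) (labelledBoundary g)
  simp only [labelledBoundary] at hspan
  set I := Ideal.span {f : MvPolynomial (A × Fin n) k |
    ∃ (ρ : A) (i j : Fin n),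
      f = X (ρ + g i, j) * X (ρ, i) - X (ρ + g j, i) * X (ρ, j)}
  apply Set.Subset.antisymm
  · let q := (algebraMap _ (Localization.Away (Ideal.Quotient.mk I (∏ p, X p)))).comp
      (Ideal.Quotient.mk I)
    have hunit : ∀ p, IsUnit (q (X p)) := by
      have h : IsUnit (q (∏ p, X p)) :=
        IsLocalization.Away.algebraMap_isUnit (Ideal.Quotient.mk I (∏ p, X p))
      rw [map_prod q, IsUnit.prod_univ_iff] at h
      exact h
    choose U hU using hunit
    have hmon : ∀ u : (A × Fin n) →₀ ℕ, q (monomial u 1) = (∏ p, U p ^ u p : _ˣ) := by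
      intro u
      rw [monomial_eq, Finsupp.prod_fintype _ _ fun _ => pow_zero _]
      simp [hU]
    have hUcomm : ∀ ρ i j, U (ρ + g i, j) * U (ρ, i) = U (ρ + g j, i) * U (ρ, j) := by
      intro ρ i j
      apply Units.ext
      have hmem : X (ρ + g i, j) * X (ρ, i) - X (ρ + g j, i) * X (ρ, j) ∈ I :=
        Ideal.subset_span ⟨ρ, i, j, rfl⟩
      have h := congrArg (algebraMap _ (Localization.Away (Ideal.Quotient.mk I (∏ p, X p))))
        (Ideal.Quotient.eq.2 hmem)
      change q _ = q _ at h
      simpa [hU] using h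
    refine fun f hf => (algebraMap_mk_eq_zero_iff_exists_pow_mul_mem I _ f).1
      ((Ideal.span_le (I := RingHom.ker q)).2 ?_ hf)
    rintro _ ⟨u, v, h, rfl⟩
    have hz := sum_zsmul_eq_zero_of_sum_zsmul_labelledBoundary_eq_zero hgen
      (F := fun ρ i => Additive.ofMul (U (ρ, i))) hUcomm
      (u := fun p => (u p : ℤ) - v p) (by
        simp only [sub_smul, Finset.sum_sub_distrib]
        exact sub_eq_zero.2 h)
    have hprod : ∏ p, U p ^ u p = ∏ p, U p ^ v p := by
      simp only [sub_smul, Finset.sum_sub_distrib, natCast_zsmul, sub_eq_zero] at hz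
      exact hz
    rw [SetLike.mem_coe, RingHom.mem_ker, map_sub, hmon, hmon, hprod, sub_self]
  · rintro f ⟨m, hm⟩
    rw [← hspan, SetLike.mem_coe, RingHom.mem_ker]
    have hI_le : I ≤ RingHom.ker (toricMap k (labelledBoundary g)) := by
      rw [Ideal.span_le]
      rintro _ ⟨ρ, i, j, rfl⟩
      simp [RingHom.mem_ker, toricMap, AddMonoidAlgebra.single_mul_single,
        labelledBoundary_add_comm g ρ i j]
    have hunit : IsUnit (toricMap k (labelledBoundary g) (∏ p, X p)) := by
      rw [map_prod, IsUnit.prod_univ_iff]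
      intro p
      refine IsUnit.of_mul_eq_one (AddMonoidAlgebra.single (-labelledBoundary g p) 1) ?_
      simp [toricMap, AddMonoidAlgebra.single_mul_single, AddMonoidAlgebra.one_def]
    have h := hI_le hm
    rw [RingHom.mem_ker, map_mul, map_pow] at h
    exact (hunit.pow m).mul_right_eq_zero.1 h
end

section
/- The ideal I is contained in the toric ideal I_C; the ideal I_C is prime and contains no variable z_i^ρ; and every prime ideal Q of k[z_i^ρ : ρ ∈ A, 1 ≤ i ≤ n] that contains I and contains no variable z_i^ρ satisfies I_C ⊆ Q. (Equivalently, I_C is the unique minimal prime of I whose zero locus does not lie in any coordinate hyperplane of 𝔸^{nr}.) -/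
open MvPolynomial

theorem mapDomainRingHom_monomial {σ L k : Type*} [AddCommMonoid L] [CommRing k]
    (c : (σ →₀ ℕ) →+ L) (u : σ →₀ ℕ) (a : k) :
    (AddMonoidAlgebra.mapDomainRingHom k c : MvPolynomial σ k →+* _) (monomial u a) =
      AddMonoidAlgebra.single (c u) a := by
  rw [← single_eq_monomial]
  simp

/-- The ring homomorphism `k[x] → k[L]` induced by a monoid homomorphism `c` on exponents has
kernel spanned by the binomials `x ^ u - x ^ v` with `c u = c v`. -/
theorem ker_mapDomainRingHom_eq_span_binomials {σ L k : Type*} [AddCommMonoid L] [CommRing k]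
    (c : (σ →₀ ℕ) →+ L) :
    RingHom.ker (AddMonoidAlgebra.mapDomainRingHom k c : MvPolynomial σ k →+* _) =
      Ideal.span {f : MvPolynomial σ k | ∃ u v, c u = c v ∧ f = monomial u 1 - monomial v 1} := by
  set J := Ideal.span {f : MvPolynomial σ k | ∃ u v, c u = c v ∧ f = monomial u 1 - monomial v 1}
    with hJ
  apply le_antisymm
  · intro f hf
    let s : L → (σ →₀ ℕ) := Function.invFun c
    have hs (u : σ →₀ ℕ) : c (s (c u)) = c u := Function.invFun_eq ⟨u, rfl⟩
    have key (f : MvPolynomial σ k) :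
        Ideal.Quotient.mk J f = Ideal.Quotient.mk J (AddMonoidAlgebra.mapDomain s
          ((AddMonoidAlgebra.mapDomainRingHom k c : MvPolynomial σ k →+* _) f)) := by
      induction f using MvPolynomial.induction_on' with
      | monomial u a =>
        rw [mapDomainRingHom_monomial, AddMonoidAlgebra.mapDomain_single, single_eq_monomial,
          Ideal.Quotient.mk_eq_mk_iff_sub_mem]
        have : (monomial u a - monomial (s (c u)) a : MvPolynomial σ k) =
            C a * (monomial u 1 - monomial (s (c u)) 1) := by
          simp [mul_sub, C_mul_monomial]
        rw [this]
        exact J.mul_mem_left _ (Ideal.subset_span ⟨_, _, (hs u).symm, rfl⟩)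
      | add p q hp hq =>
        rw [map_add, map_add, AddMonoidAlgebra.mapDomain_add, hp, hq, ← map_add]
    rw [← Ideal.Quotient.eq_zero_iff_mem, key, RingHom.mem_ker.mp hf]
    simp
  · rw [hJ, Ideal.span_le]
    rintro _ ⟨u, v, huv, rfl⟩
    rw [SetLike.mem_coe, RingHom.mem_ker, map_sub, mapDomainRingHom_monomial,
      mapDomainRingHom_monomial, huv, sub_self]

/-- If a `W`-valued edge weight `φ` on the Cayley graph of `(A, g)` becomes, in an abelian group
containing `W`, a coboundary up to a factor depending only on the type of the edge, then the
product of `φ` along `u` depends only on the boundary of `u` and its number of edges per type. -/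
theorem prod_pow_eq_of_coboundary {A ι W B : Type*} [AddCommGroup A] [Fintype A] [DecidableEq A]
    [Fintype ι] [DecidableEq ι] [CommGroup W] [AddCommGroup B] (g : ι → A) (φ : A × ι → W)
    (D : Additive W →+ B) (hD : Function.Injective D) (T : ι → B) (t : A → B)
    (hDT : ∀ p : A × ι, D (.ofMul (φ p)) = t p.1 - t (p.1 + g p.2) + T p.2)
    {u v : A × ι → ℕ}
    (huv : (∑ p : A × ι, (u p : ℤ) •
        ((Pi.single p.1 (1 : ℤ) - Pi.single (p.1 + g p.2) 1 : A → ℤ),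
          (Pi.single p.2 (1 : ℤ) : ι → ℤ))) =
      ∑ p : A × ι, (v p : ℤ) •
        ((Pi.single p.1 (1 : ℤ) - Pi.single (p.1 + g p.2) 1 : A → ℤ),
          (Pi.single p.2 (1 : ℤ) : ι → ℤ))) :
    ∏ p, φ p ^ u p = ∏ p, φ p ^ v p := by
  let ψ : (A → ℤ) × (ι → ℤ) →ₗ[ℤ] B :=
    (Fintype.linearCombination ℤ t).coprod (Fintype.linearCombination ℤ T)
  have hψ (w : A × ι → ℕ) : ψ (∑ p : A × ι, (w p : ℤ) •
        ((Pi.single p.1 (1 : ℤ) - Pi.single (p.1 + g p.2) 1 : A → ℤ),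
          (Pi.single p.2 (1 : ℤ) : ι → ℤ))) = D (.ofMul (∏ p, φ p ^ w p)) := by
    rw [map_sum, ofMul_prod, map_sum]
    refine Finset.sum_congr rfl fun p _ => ?_
    rw [map_smul, ofMul_pow, map_nsmul, hDT, natCast_zsmul]
    simp [ψ, Fintype.linearCombination_apply_single]
  exact Additive.ofMul.injective (hD (by rw [← hψ, ← hψ, huv]))

/-- Parallel transport along the edges of type `i`: the permutation of `A × W` sending `(ρ, w)` to
`(ρ + g i, φ (ρ, i) * w)`. -/
def edgeTransport {A ι W : Type*} [AddCommGroup A] [CommGroup W] (g : ι → A) (φ : A × ι → W)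
    (i : ι) : Equiv.Perm (A × W) where
  toFun x := (x.1 + g i, φ (x.1, i) * x.2)
  invFun x := (x.1 - g i, (φ (x.1 - g i, i))⁻¹ * x.2)
  left_inv x := by simp
  right_inv x := by simp

/-- The action of `W` on `A × W` by multiplication on the second factor. -/
def fibreMul (A W : Type*) [CommGroup W] : W →* Equiv.Perm (A × W) where
  toFun w := (Equiv.refl A).prodCongr (Equiv.mulLeft w)
  map_one' := by ext <;> simp
  map_mul' v w := by ext <;> simp [mul_assoc]

open scoped IsMulCommutative in
/-- A `W`-valued edge weight on the Cayley graph of `(A, g)` with trivial holonomy around the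
commutator squares has product along `u` depending only on the boundary of `u` and its number of
edges per type. -/
theorem prod_pow_eq_of_flat {A ι W : Type*} [AddCommGroup A] [Fintype A] [DecidableEq A]
    [Fintype ι] [DecidableEq ι] [CommGroup W] (g : ι → A)
    (hgen : AddSubgroup.closure (Set.range g) = ⊤) (φ : A × ι → W)
    (hφ : ∀ ρ i j, φ (ρ + g i, j) * φ (ρ, i) = φ (ρ + g j, i) * φ (ρ, j))
    {u v : A × ι → ℕ}
    (huv : (∑ p : A × ι, (u p : ℤ) •
        ((Pi.single p.1 (1 : ℤ) - Pi.single (p.1 + g p.2) 1 : A → ℤ),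
          (Pi.single p.2 (1 : ℤ) : ι → ℤ))) =
      ∑ p : A × ι, (v p : ℤ) •
        ((Pi.single p.1 (1 : ℤ) - Pi.single (p.1 + g p.2) 1 : A → ℤ),
          (Pi.single p.2 (1 : ℤ) : ι → ℤ))) :
    ∏ p, φ p ^ u p = ∏ p, φ p ^ v p := by
  let S : Set (Equiv.Perm (A × W)) := Set.range (edgeTransport g φ) ∪ Set.range (fibreMul A W)
  have hS : ∀ a ∈ S, ∀ b ∈ S, a * b = b * a := by
    rintro _ (⟨i, rfl⟩ | ⟨w, rfl⟩) _ (⟨j, rfl⟩ | ⟨w', rfl⟩) <;> ext x <;>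
      simp [edgeTransport, fibreMul, add_right_comm, mul_left_comm]
    rw [← mul_assoc, ← mul_assoc, mul_comm (φ _), hφ, mul_comm (φ _)]
  let H := Subgroup.closure S
  have : IsMulCommutative H := Subgroup.isMulCommutative_closure hS
  let D : W →* H := (fibreMul A W).codRestrict H fun w => Subgroup.subset_closure (.inr ⟨w, rfl⟩)
  let T (i : ι) : H := ⟨edgeTransport g φ i, Subgroup.subset_closure (.inl ⟨i, rfl⟩)⟩
  have D_apply (w : W) (x : A × W) : (D w).1 x = (x.1, w * x.2) := rfl
  have T_apply (i : ι) (x : A × W) : (T i).1 x = (x.1 + g i, φ (x.1, i) * x.2) := rfl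
  have shift (ρ : A) : ∃ h : H, ∀ x, (h.1 x).1 = x.1 + ρ := by
    have hρ : ρ ∈ AddSubgroup.closure (Set.range g) := hgen ▸ AddSubgroup.mem_top ρ
    induction hρ using AddSubgroup.closure_induction with
    | mem _ h =>
      obtain ⟨i, rfl⟩ := h
      exact ⟨T i, fun x => rfl⟩
    | zero => exact ⟨1, fun x => by simp⟩
    | add a b _ _ ha hb =>
      obtain ⟨h, hh⟩ := ha
      obtain ⟨h', hh'⟩ := hb
      exact ⟨h' * h, fun x => by simp [hh, hh', add_assoc]⟩
    | neg a _ ha =>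
      obtain ⟨h, hh⟩ := ha
      refine ⟨h⁻¹, fun x => ?_⟩
      have := hh (h.1⁻¹ x)
      rw [← Equiv.Perm.mul_apply, mul_inv_cancel, Equiv.Perm.one_apply] at this
      exact eq_add_neg_of_add_eq this.symm
  have transitive (x : A × W) : ∃ h : H, h.1 (0, 1) = x := by
    obtain ⟨h, hh⟩ := shift x.1
    refine ⟨D (x.2 * (h.1 (0, 1)).2⁻¹) * h, ?_⟩
    rw [Subgroup.coe_mul, Equiv.Perm.mul_apply, D_apply]
    ext <;> simp [hh]
  have ext_point {a b : H} (hab : a.1 (0, 1) = b.1 (0, 1)) : a = b := by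
    refine Subtype.ext (Equiv.ext fun x => ?_)
    obtain ⟨h, rfl⟩ := transitive x
    have ha := congrArg (fun c : H => c.1 (0, 1)) (mul_comm a h)
    have hb := congrArg (fun c : H => c.1 (0, 1)) (mul_comm b h)
    simp only [Subgroup.coe_mul, Equiv.Perm.mul_apply] at ha hb
    rw [ha, hb, hab]
  choose t ht using fun ρ : A => transitive (ρ, 1)
  refine prod_pow_eq_of_coboundary (B := Additive H) g φ D.toAdditive ?_
    (fun i => .ofMul (T i)) (fun ρ => .ofMul (t ρ)) (fun p => ?_) huv
  · intro a b hab
    have := congrArg (fun c : H => (c.1 (0, 1)).2) (Additive.ofMul.injective hab)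
    simpa [D_apply] using this
  · have : D (φ p) * t (p.1 + g p.2) = T p.2 * t p.1 := ext_point (by
      simp [D_apply, T_apply, ht])
    change Additive.ofMul (D (φ p)) = _
    rw [eq_mul_inv_of_mul_eq this]
    simp only [ofMul_mul, ofMul_inv]
    abel

/-!
Statement 5: `I ⊆ I_C`; the toric ideal `I_C` is prime and contains no variable;
and every prime ideal `Q ⊇ I` containing no variable satisfies `I_C ⊆ Q`.
(So `I_C` is the unique minimal prime of `I` whose zero locus lies in no
coordinate hyperplane.)
-/
theorem mckay_toric_ideal_unique_minimal_prime
    {A : Type*} [AddCommGroup A] [Fintype A] [DecidableEq A] {n : ℕ}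
    (hn : 1 ≤ n) (g : Fin n → A)
    (hgen : AddSubgroup.closure (Set.range g) = ⊤)
    (k : Type*) [Field k] [IsAlgClosed k]
    (hchar : ¬ (ringChar k ∣ Fintype.card A))
    (I IC : Ideal (MvPolynomial (A × Fin n) k))
    (hI : I = Ideal.span {f : MvPolynomial (A × Fin n) k |
        ∃ (ρ : A) (i j : Fin n),
          f = X (ρ + g i, j) * X (ρ, i) - X (ρ + g j, i) * X (ρ, j)})
    (hIC : IC = Ideal.span {f : MvPolynomial (A × Fin n) k |
        ∃ (u v : (A × Fin n) →₀ ℕ),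
          (∑ p : A × Fin n, (u p : ℤ) •
              ((Pi.single p.1 (1 : ℤ) - Pi.single (p.1 + g p.2) 1 : A → ℤ),
               (Pi.single p.2 (1 : ℤ) : Fin n → ℤ)))
            = (∑ p : A × Fin n, (v p : ℤ) •
              ((Pi.single p.1 (1 : ℤ) - Pi.single (p.1 + g p.2) 1 : A → ℤ),
               (Pi.single p.2 (1 : ℤ) : Fin n → ℤ))) ∧
          f = monomial u 1 - monomial v 1}) :
    I ≤ IC ∧ IC.IsPrime ∧ (∀ p : A × Fin n, X p ∉ IC) ∧
      ∀ Q : Ideal (MvPolynomial (A × Fin n) k),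
        Q.IsPrime → I ≤ Q → (∀ p : A × Fin n, X p ∉ Q) → IC ≤ Q := by
  let e : A × Fin n → (A → ℤ) × (Fin n → ℤ) := fun p =>
    ((Pi.single p.1 (1 : ℤ) - Pi.single (p.1 + g p.2) 1 : A → ℤ), (Pi.single p.2 (1 : ℤ)))
  let c : ((A × Fin n) →₀ ℕ) →+ (A → ℤ) × (Fin n → ℤ) :=
    { toFun u := ∑ p, (u p : ℤ) • e p
      map_zero' := by simp
      map_add' u v := by simp [add_smul, Finset.sum_add_distrib] }
  have hc (p : A × Fin n) : c (Finsupp.single p 1) = e p := by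
    change ∑ q, ((Finsupp.single p 1 : (A × Fin n) →₀ ℕ) q : ℤ) • e q = e p
    rw [Finset.sum_eq_single p] <;> simp +contextual [eq_comm]
  have hker := ker_mapDomainRingHom_eq_span_binomials (k := k) c
  refine ⟨?_, ?_, fun p hp => ?_, fun Q hQ hIQ hX => ?_⟩
  · rw [hI, hIC, Ideal.span_le]
    rintro _ ⟨ρ, i, j, rfl⟩
    refine Ideal.subset_span ⟨Finsupp.single (ρ + g i, j) 1 + Finsupp.single (ρ, i) 1,
      Finsupp.single (ρ + g j, i) 1 + Finsupp.single (ρ, j) 1, ?_, ?_⟩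
    · change c _ = c _
      rw [map_add, map_add, hc, hc, hc, hc]
      simp only [e, Prod.mk_add_mk, add_right_comm ρ (g j) (g i), Prod.mk.injEq]
      exact ⟨by abel, add_comm _ _⟩
    · simp [X, monomial_mul]
  · rw [hIC]
    refine hker ▸ RingHom.ker_isPrime _
  · replace hp := hker.ge (hIC ▸ hp)
    rw [RingHom.mem_ker, X, mapDomainRingHom_monomial] at hp
    simp at hp
  · rw [hIC, Ideal.span_le]
    rintro _ ⟨u, v, huv, rfl⟩
    let θ := (algebraMap (MvPolynomial (A × Fin n) k ⧸ Q)
      (FractionRing (MvPolynomial (A × Fin n) k ⧸ Q))).comp (Ideal.Quotient.mk Q)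
    have hθ (f) : θ f = 0 ↔ f ∈ Q := by
      simp [θ, Ideal.Quotient.eq_zero_iff_mem]
    let φ (p : A × Fin n) := Units.mk0 (θ (X p)) (mt (hθ _).mp (hX p))
    have hφ (ρ : A) (i j : Fin n) :
        φ (ρ + g i, j) * φ (ρ, i) = φ (ρ + g j, i) * φ (ρ, j) := by
      refine Units.ext ?_
      change θ _ * θ _ = θ _ * θ _
      rw [← map_mul, ← map_mul, ← sub_eq_zero, ← map_sub, hθ]
      exact hIQ (hI ▸ Ideal.subset_span ⟨ρ, i, j, rfl⟩)
    have hprod := congrArg Units.val (prod_pow_eq_of_flat g hgen φ hφ huv)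
    have hmon (w : (A × Fin n) →₀ ℕ) : θ (monomial w 1) = ((∏ p, φ p ^ w p : Units _) : _) := by
      rw [monomial_eq, Finsupp.prod_fintype _ _ (by simp)]
      simp [φ]
    rw [SetLike.mem_coe, ← hθ, map_sub, hmon, hmon, hprod, sub_self]
end

section
/- A vector w ∈ ℤ^n satisfies (0, w) ∈ ℤC (i.e., (0,w) lies in the image of the map C) if and only if w ∈ M, where M is the kernel of the group homomorphism deg : ℤ^n → A sending e_i to g_i. In other words, the projection to the ℤ^n-factor restricts to a group isomorphism from {x ∈ ℤC : the ℤ^A-component of x is 0} onto M. -/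
/-- Every column `(e_ρ - e_{ρ + g i}, e_i)` is killed by the map
`(v, u) ↦ ∑ a, v a • a + ∑ i, u i • g i`, hence so is the subgroup they generate. -/
theorem weight_eq_zero_of_mem_closure_columns
    {A ι : Type*} [AddCommGroup A] [Fintype A] [DecidableEq A] [Fintype ι] [DecidableEq ι]
    (g : ι → A) {x : (A → ℤ) × (ι → ℤ)}
    (hx : x ∈ AddSubgroup.closure
        (Set.range fun p : A × ι =>
          ((Pi.single p.1 (1 : ℤ) - Pi.single (p.1 + g p.2) 1 : A → ℤ),
           (Pi.single p.2 (1 : ℤ) : ι → ℤ)))) :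
    ∑ a, x.1 a • a + ∑ i, x.2 i • g i = 0 := by
  induction hx using AddSubgroup.closure_induction with
  | mem x hx =>
    obtain ⟨⟨ρ, i⟩, rfl⟩ := hx
    simp [Pi.single_apply, sub_smul, ite_smul, Finset.sum_sub_distrib]
  | zero => simp
  | add x y _ _ hx hy =>
    simp only [Prod.fst_add, Prod.snd_add, Pi.add_apply, add_smul, Finset.sum_add_distrib]
    rw [add_add_add_comm, hx, hy, add_zero]
  | neg x _ hx =>
    simp only [Prod.fst_neg, Prod.snd_neg, Pi.neg_apply, neg_smul, Finset.sum_neg_distrib]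
    rw [← neg_add, hx, neg_zero]

/-- Concatenating arrows gives paths: if a subgroup contains all columns
`(e_ρ - e_{ρ + g i}, e_i)`, then it contains `(e_ρ - e_{ρ + deg u}, u)` for every `ρ` and `u`. -/
theorem path_mem_of_columns_mem
    {A ι : Type*} [AddCommGroup A] [DecidableEq A] [Fintype ι] [DecidableEq ι]
    (g : ι → A) (H : AddSubgroup ((A → ℤ) × (ι → ℤ)))
    (hH : ∀ ρ i, ((Pi.single ρ (1 : ℤ) - Pi.single (ρ + g i) 1 : A → ℤ),
      (Pi.single i (1 : ℤ) : ι → ℤ)) ∈ H)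
    (u : ι → ℤ) (ρ : A) :
    ((Pi.single ρ (1 : ℤ) - Pi.single (ρ + ∑ i, u i • g i) 1 : A → ℤ), u) ∈ H := by
  let K : AddSubgroup (ι → ℤ) :=
    { carrier := {u | ∀ ρ : A,
        ((Pi.single ρ (1 : ℤ) - Pi.single (ρ + ∑ i, u i • g i) 1 : A → ℤ), u) ∈ H}
      zero_mem' := fun ρ => by
        convert H.zero_mem using 1
        simp
      add_mem' := fun {u v} hu hv ρ => by
        convert H.add_mem (hu ρ) (hv (ρ + ∑ i, u i • g i)) using 1
        simp [add_smul, Finset.sum_add_distrib, add_assoc]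
      neg_mem' := fun {u} hu ρ => by
        convert H.neg_mem (hu (ρ - ∑ i, u i • g i)) using 1
        simp [sub_eq_add_neg] }
  have hK (i : ι) : Pi.single i (1 : ℤ) ∈ K := fun ρ => by
    simpa [Pi.single_apply, ite_smul] using hH ρ i
  have hu : u ∈ K := by
    rw [pi_eq_sum_univ' u]
    exact K.sum_mem fun i _ => K.zsmul_mem (by simpa [Pi.single_apply] using hK i) (u i)
  exact hu ρ

/-!
Statement 6: A vector `w ∈ ℤ^n` satisfies `(0, w) ∈ ℤC` — where `ℤC` is the
subgroup of `ℤ^A × ℤ^n` generated by the columns `C(e_i^ρ) = (e_ρ − e_{ρ+g i}, e_i)`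
— if and only if `w ∈ M = ker(deg : ℤ^n → A)`, where `deg(e_i) = g i`, i.e.
if and only if `∑ i, w i • g i = 0`.  (Equivalently, projection to the
`ℤ^n`-factor is a group isomorphism from `{x ∈ ℤC : x₁ = 0}` onto `M`.)
-/
theorem mckay_lattice_slice_eq_M
    {A : Type*} [AddCommGroup A] [Fintype A] [DecidableEq A] {n : ℕ}
    (hn : 1 ≤ n) (g : Fin n → A)
    (hgen : AddSubgroup.closure (Set.range g) = ⊤)
    (w : Fin n → ℤ) :
    ((0, w) ∈ AddSubgroup.closure
        (Set.range fun p : A × Fin n =>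
          ((Pi.single p.1 (1 : ℤ) - Pi.single (p.1 + g p.2) 1 : A → ℤ),
           (Pi.single p.2 (1 : ℤ) : Fin n → ℤ))))
      ↔ ∑ i, w i • g i = 0 := by
  constructor
  · intro h
    simpa using weight_eq_zero_of_mem_closure_columns g h
  · intro h
    have hpath := path_mem_of_columns_mem g
      (AddSubgroup.closure (Set.range fun p : A × Fin n =>
        ((Pi.single p.1 (1 : ℤ) - Pi.single (p.1 + g p.2) 1 : A → ℤ),
         (Pi.single p.2 (1 : ℤ) : Fin n → ℤ))))
      (fun ρ i => AddSubgroup.subset_closure ⟨(ρ, i), rfl⟩) w 0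
    rw [h, add_zero, sub_self] at hpath
    exact hpath
end

section
/- A vector w ∈ ℤ^n satisfies (0, w) ∈ ℕC (i.e., (0,w) lies in the submonoid of ℤ^A × ℤ^n generated by the vectors C(e_i^ρ)) if and only if w ∈ ℕ^n ∩ M, i.e., all coordinates of w are nonnegative and w lies in the kernel M of the homomorphism deg : ℤ^n → A sending e_i to g_i. In other words, the projection to the ℤ^n-factor restricts to a monoid isomorphism from {x ∈ ℕC : the ℤ^A-component of x is 0} onto ℕ^n ∩ M. -/
section McKaySemigroup

variable {A ι : Type*} [AddCommGroup A] [DecidableEq A] [DecidableEq ι]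

/-- The semigroup `ℕC` generated by the vectors `(e_ρ − e_{ρ + g i}, e_i)`. -/
abbrev mckaySemigroup (g : ι → A) : AddSubmonoid ((A → ℤ) × (ι → ℤ)) :=
  AddSubmonoid.closure (Set.range fun p : A × ι =>
    ((Pi.single p.1 (1 : ℤ) - Pi.single (p.1 + g p.2) 1 : A → ℤ),
      (Pi.single p.2 (1 : ℤ) : ι → ℤ)))

theorem nonneg_of_mem_mckaySemigroup {g : ι → A} {x : (A → ℤ) × (ι → ℤ)}
    (hx : x ∈ mckaySemigroup g) : 0 ≤ x.2 := by
  induction hx using AddSubmonoid.closure_induction with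
  | mem x hx =>
    obtain ⟨p, rfl⟩ := hx
    exact Pi.single_nonneg.2 zero_le_one
  | zero => exact le_rfl
  | add x y _ _ hx hy => exact add_nonneg hx hy

/-- The total character `∑ u_ρ ρ + ∑ w_i g_i` vanishes on `ℕC`. -/
theorem sum_smul_add_sum_smul_of_mem_mckaySemigroup [Fintype A] [Fintype ι] {g : ι → A}
    {x : (A → ℤ) × (ι → ℤ)} (hx : x ∈ mckaySemigroup g) :
    ∑ a, x.1 a • a + ∑ i, x.2 i • g i = 0 := by
  induction hx using AddSubmonoid.closure_induction with
  | mem x hx =>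
    obtain ⟨p, rfl⟩ := hx
    simp [sub_smul, Pi.single_apply, ite_smul]
  | zero => simp
  | add x y _ _ hx hy =>
    simp only [Prod.fst_add, Prod.snd_add, Pi.add_apply, add_smul, Finset.sum_add_distrib]
    rw [add_add_add_comm, hx, hy, add_zero]

theorem mem_closure_range_single_of_nonneg [Fintype ι] {w : ι → ℤ} (hw : 0 ≤ w) :
    w ∈ AddSubmonoid.closure (Set.range fun i : ι => (Pi.single i 1 : ι → ℤ)) := by
  rw [← Finset.univ_sum_single w]
  refine sum_mem fun i _ => ?_
  obtain ⟨k, hk⟩ := Int.eq_ofNat_of_zero_le (hw i)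
  have h : (Pi.single i (w i) : ι → ℤ) = k • Pi.single i 1 := by
    rw [hk, ← Pi.single_smul]
    simp
  rw [h]
  exact nsmul_mem (AddSubmonoid.subset_closure (Set.mem_range_self i)) k

/-- A nonnegative vector `w` is the class of a path in the McKay quiver from any given vertex. -/
theorem single_sub_single_mem_mckaySemigroup [Fintype ι] (g : ι → A) {w : ι → ℤ}
    (hw : 0 ≤ w) (ρ : A) :
    ((Pi.single ρ 1 - Pi.single (ρ + ∑ i, w i • g i) 1 : A → ℤ), w) ∈ mckaySemigroup g := by
  replace hw := mem_closure_range_single_of_nonneg hw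
  induction hw using AddSubmonoid.closure_induction generalizing ρ with
  | mem w hw =>
    obtain ⟨i, rfl⟩ := hw
    refine AddSubmonoid.subset_closure ⟨(ρ, i), ?_⟩
    simp [Pi.single_apply, ite_smul]
  | zero => simp [← Prod.zero_eq_mk]
  | add v w _ _ hv hw =>
    convert add_mem (hv ρ) (hw (ρ + ∑ i, v i • g i)) using 1
    simp [add_smul, Finset.sum_add_distrib, add_assoc]

end McKaySemigroup

/-!
Statement 7: A vector `w ∈ ℤ^n` satisfies `(0, w) ∈ ℕC` — where `ℕC` is the
additive submonoid of `ℤ^A × ℤ^n` generated by the columns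
`C(e_i^ρ) = (e_ρ − e_{ρ+g i}, e_i)` — if and only if `w ∈ ℕ^n ∩ M`, i.e. all
coordinates of `w` are nonnegative and `∑ i, w i • g i = 0` (so `w` lies in the
kernel `M` of `deg : ℤ^n → A`, `deg(e_i) = g i`).
-/
theorem mckay_semigroup_slice_eq_Nn_cap_M
    {A : Type*} [AddCommGroup A] [Fintype A] [DecidableEq A] {n : ℕ}
    (hn : 1 ≤ n) (g : Fin n → A)
    (hgen : AddSubgroup.closure (Set.range g) = ⊤)
    (w : Fin n → ℤ) :
    ((0, w) ∈ AddSubmonoid.closure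
        (Set.range fun p : A × Fin n =>
          ((Pi.single p.1 (1 : ℤ) - Pi.single (p.1 + g p.2) 1 : A → ℤ),
           (Pi.single p.2 (1 : ℤ) : Fin n → ℤ))))
      ↔ (∀ i, 0 ≤ w i) ∧ ∑ i, w i • g i = 0 := by
  refine ⟨fun h => ⟨nonneg_of_mem_mckaySemigroup h, ?_⟩, fun ⟨hw, hs⟩ => ?_⟩
  · simpa using sum_smul_add_sum_smul_of_mem_mckaySemigroup h
  · simpa [hs] using single_sub_single_mem_mckaySemigroup g hw 0
end

section
/- For every θ ∈ ℤ^A with Σ_{ρ ∈ A} θ_ρ = 0, the convex hull in ℚ^n of the set { D(u) : u ∈ ℕ^{A×n}, B(u) = θ } is equal to the set { D(u) : u ∈ ℚ^{A×n}, u ≥ 0 componentwise, B(u) = θ }. (This states the correctness of computing the polyhedron P_θ = conv(π_n(ℕC ∩ π^{−1}(θ))) as the image under D of the rational polyhedron { u ∈ ℚ^{A×n}_{≥0} : Bu = θ }.) -/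
/-- The incidence map of the directed multigraph with edges `E`, where the edge `e` runs from
`s e` to `t e`. -/
def incidenceMap {E V : Type*} [Fintype E] [DecidableEq V] (s t : E → V) :
    (E → ℚ) →ₗ[ℚ] (V → ℚ) :=
  Fintype.linearCombination ℚ fun e => Pi.single (s e) (1 : ℚ) - Pi.single (t e) 1

/-- The set of edges on which `u` takes a non-integral value. -/
def fracSupport {E : Type*} [Fintype E] (u : E → ℚ) : Finset E :=
  Finset.univ.filter fun e => Int.fract (u e) ≠ 0

theorem mem_fracSupport {E : Type*} [Fintype E] {u : E → ℚ} {e : E} :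
    e ∈ fracSupport u ↔ Int.fract (u e) ≠ 0 := by
  simp [fracSupport]

section Incidence

variable {E V : Type*} [Fintype E] [DecidableEq V] (s t : E → V)

theorem incidenceMap_apply (u : E → ℚ) (v : V) :
    incidenceMap s t u v =
      ∑ e, u e * ((if s e = v then 1 else 0) - (if t e = v then 1 else 0)) := by
  simp [incidenceMap, Fintype.linearCombination_apply, Finset.sum_apply, Pi.single_apply,
    eq_comm]

theorem sum_incidenceMap [Fintype V] (u : E → ℚ) : ∑ v, incidenceMap s t u v = 0 := by
  simp_rw [incidenceMap_apply]
  rw [Finset.sum_comm]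
  simp [← Finset.mul_sum]

/-- If the boundary of `u` is integral, then a vertex incident to a non-loop edge with fractional
value is incident to at least two such edges. -/
theorem two_le_card_incident {u : E → ℚ} {θ : V → ℤ}
    (hu : ∀ v, incidenceMap s t u v = θ v) (hloop : ∀ e ∈ fracSupport u, s e ≠ t e)
    {v : V} {e : E} (he : e ∈ fracSupport u) (hev : s e = v ∨ t e = v) :
    2 ≤ ((fracSupport u).filter fun e => s e = v ∨ t e = v).card := by
  classical
  by_contra! hlt
  have hone : ∀ e' ∈ fracSupport u, (s e' = v ∨ t e' = v) → e' = e := fun e' he' hv' =>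
    Finset.card_le_one.1 (Nat.le_of_lt_succ hlt) e' (by simp [he', hv']) e (by simp [he, hev])
  have hint : ∀ e' ∈ Finset.univ.erase e,
      u e' * ((if s e' = v then 1 else 0) - (if t e' = v then 1 else 0)) =
        ((⌊u e'⌋ * ((if s e' = v then 1 else 0) - (if t e' = v then 1 else 0)) : ℤ) : ℚ) := by
    intro e' he'
    by_cases hf : e' ∈ fracSupport u
    · have : ¬ (s e' = v ∨ t e' = v) := fun h => (Finset.mem_erase.1 he').1 (hone e' hf h)
      rw [not_or] at this
      simp [this.1, this.2]
    · have h0 : Int.fract (u e') = 0 := by simpa [mem_fracSupport] using hf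
      have : (⌊u e'⌋ : ℚ) = u e' := by linarith [Int.floor_add_fract (u e')]
      push_cast
      rw [this]
  have h := hu v
  rw [incidenceMap_apply, ← Finset.add_sum_erase _ _ (Finset.mem_univ e),
    Finset.sum_congr rfl hint, ← Int.cast_sum] at h
  refine mem_fracSupport.1 he ?_
  generalize (∑ e' ∈ Finset.univ.erase e, _ : ℤ) = k at h
  have hst := hloop e he
  rcases hev with hv | hv
  · have hv' : t e ≠ v := fun h => hst (hv.trans h.symm)
    have : u e = ((θ v - k : ℤ) : ℚ) := by
      simp only [hv, hv', if_true, if_false] at h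
      push_cast
      linarith
    rw [this, Int.fract_intCast]
  · have hv' : s e ≠ v := fun h => hst (h.trans hv.symm)
    have : u e = ((k - θ v : ℤ) : ℚ) := by
      simp only [hv, hv', if_true, if_false] at h
      push_cast
      linarith
    rw [this, Int.fract_intCast]

/-- A vector with integral boundary and some non-integral value admits a nonzero circulation
supported on its non-integral values. -/
theorem exists_circulation_of_fracSupport_nonempty [Fintype V] {u : E → ℚ} {θ : V → ℤ}
    (hu : ∀ v, incidenceMap s t u v = θ v) (hne : (fracSupport u).Nonempty) :
    ∃ w : E → ℚ, w ≠ 0 ∧ (∀ e, w e ≠ 0 → e ∈ fracSupport u) ∧ incidenceMap s t w = 0 := by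
  classical
  by_cases hloop : ∃ e ∈ fracSupport u, s e = t e
  · obtain ⟨e, he, hst⟩ := hloop
    refine ⟨Pi.single e 1, by simp, fun e' he' => ?_, ?_⟩
    · by_contra hcon
      exact he' (Pi.single_eq_of_ne (fun h : e' = e => hcon (h.symm ▸ he)) _)
    · simp [incidenceMap, hst]
  push Not at hloop
  obtain ⟨e₀, he₀⟩ := hne
  set F := fracSupport u
  let W : Finset V := Finset.univ.filter fun v => ∃ e ∈ F, s e = v ∨ t e = v
  have hcard : W.card ≤ F.card := by
    have := Finset.card_mul_le_card_mul (s := W) (t := F) (m := 2) (n := 2)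
      (fun v e => s e = v ∨ t e = v) ?_ ?_
    · omega
    · intro v hv
      obtain ⟨e, he, hev⟩ := (Finset.mem_filter.1 hv).2
      exact two_le_card_incident s t hu hloop he hev
    · intro e _
      refine (Finset.card_le_card (t := {s e, t e}) ?_).trans Finset.card_le_two
      intro v hv
      have := (Finset.mem_filter.1 hv).2
      simp only [Finset.mem_insert, Finset.mem_singleton]
      exact this.imp Eq.symm Eq.symm
  have hs₀ : s e₀ ∈ W := by simpa [W] using ⟨e₀, he₀, Or.inl rfl⟩
  let ext : (F → ℚ) →ₗ[ℚ] (E → ℚ) := LinearMap.pi fun e =>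
    if h : e ∈ F then LinearMap.proj ⟨e, h⟩ else 0
  let L : (F → ℚ) →ₗ[ℚ] (W.erase (s e₀) → ℚ) :=
    LinearMap.funLeft ℚ ℚ Subtype.val ∘ₗ incidenceMap s t ∘ₗ ext
  have hker : L.ker ≠ ⊥ := by
    apply LinearMap.ker_ne_bot_of_finrank_lt
    simp only [Module.finrank_fintype_fun_eq_card, Fintype.card_coe, Finset.card_erase_of_mem hs₀]
    have := Finset.card_pos.2 ⟨_, hs₀⟩
    omega
  obtain ⟨x, hx, hx0⟩ := Submodule.exists_mem_ne_zero_of_ne_bot hker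
  have hsupp : ∀ e, ext x e ≠ 0 → e ∈ F := by
    intro e he
    by_contra hcon
    exact he (by simp [ext, hcon])
  have hzero : ∀ v, v ≠ s e₀ → incidenceMap s t (ext x) v = 0 := by
    intro v hv
    by_cases hvW : v ∈ W
    · exact congrFun (LinearMap.mem_ker.1 hx) ⟨v, Finset.mem_erase.2 ⟨hv, hvW⟩⟩
    · rw [incidenceMap_apply]
      refine Finset.sum_eq_zero fun e _ => ?_
      by_cases he : e ∈ F
      · have : ¬ (s e = v ∨ t e = v) := fun h => hvW (by simpa [W] using ⟨e, he, h⟩)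
        rw [not_or] at this
        simp [this.1, this.2]
      · rw [not_imp_comm.1 (hsupp e) he, zero_mul]
  refine ⟨ext x, fun h => hx0 ?_, hsupp, ?_⟩
  · ext ⟨e, he⟩
    simpa [ext, he] using congrFun h e
  · ext v
    by_cases hv : v = s e₀
    · have := sum_incidenceMap s t (ext x)
      rw [Finset.sum_eq_single (s e₀) (fun v _ hv => hzero v hv) (by simp)] at this
      rw [hv, this, Pi.zero_apply]
    · exact hzero v hv

end Incidence

/-- Moving from `u` along a direction supported on its non-integral values, one can stop when a
further value becomes integral, without crossing an integer in any coordinate. -/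
theorem exists_pos_fracSupport_add_smul_ssubset {E : Type*} [Fintype E] {u w : E → ℚ}
    (hw : w ≠ 0) (hsupp : ∀ e, w e ≠ 0 → e ∈ fracSupport u) :
    ∃ c : ℚ, 0 < c ∧ (∀ e, (⌊u e⌋ : ℚ) ≤ (u + c • w) e) ∧
      fracSupport (u + c • w) ⊂ fracSupport u := by
  let r : E → ℚ := fun e => if 0 < w e then (⌊u e⌋ + 1 - u e) / w e else (⌊u e⌋ - u e) / w e
  obtain ⟨e₁, he₁⟩ := Function.ne_iff.1 hw
  obtain ⟨e₀, he₀, hmin⟩ := Finset.exists_min_image (Finset.univ.filter fun e => w e ≠ 0) r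
    ⟨e₁, by simpa using he₁⟩
  replace he₀ : w e₀ ≠ 0 := by simpa using he₀
  have hfloor : ∀ e, w e ≠ 0 → (⌊u e⌋ : ℚ) < u e := fun e he =>
    lt_of_le_of_ne (Int.floor_le _) fun h =>
      mem_fracSupport.1 (hsupp e he) (by rw [← h, Int.fract_intCast])
  have hr : 0 < r e₀ := by
    rcases lt_or_gt_of_ne he₀ with h | h
    · simp only [r, if_neg h.not_gt]
      exact div_pos_of_neg_of_neg (by linarith [hfloor e₀ he₀]) h
    · simp only [r, if_pos h]
      exact div_pos (by linarith [Int.lt_floor_add_one (u e₀)]) h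
  refine ⟨r e₀, hr, fun e => ?_, ?_⟩
  · simp only [Pi.add_apply, Pi.smul_apply, smul_eq_mul]
    rcases lt_trichotomy (w e) 0 with h | h | h
    · have hle := hmin e (by simpa using h.ne)
      simp only [r, if_neg h.not_gt] at hle
      rw [le_div_iff_of_neg h] at hle
      linarith
    · rw [h, mul_zero, add_zero]
      exact Int.floor_le _
    · have := mul_pos hr h
      linarith [Int.floor_le (u e)]
  · refine Finset.ssubset_iff_subset_ne.2 ⟨fun e he => ?_, fun heq => ?_⟩
    · by_cases h : w e = 0
      · simpa [mem_fracSupport, h] using he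
      · exact hsupp e h
    · have hmem := hsupp e₀ he₀
      rw [← heq, mem_fracSupport] at hmem
      apply hmem
      simp only [Pi.add_apply, Pi.smul_apply, smul_eq_mul]
      by_cases h : 0 < w e₀
      · have : u e₀ + r e₀ * w e₀ = ((⌊u e₀⌋ + 1 : ℤ) : ℚ) := by
          simp only [r, if_pos h, div_mul_cancel₀ _ he₀]
          push_cast
          ring
        rw [this, Int.fract_intCast]
      · have : u e₀ + r e₀ * w e₀ = (⌊u e₀⌋ : ℚ) := by
          simp only [r, if_neg h, div_mul_cancel₀ _ he₀]
          ring
        rw [this, Int.fract_intCast]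

/-- Every nonnegative rational flow with integral boundary is a convex combination of nonnegative
integral flows with the same boundary. -/
theorem mem_convexHull_natFlows {E V : Type*} [Fintype E] [Fintype V] [DecidableEq V]
    (s t : E → V) (θ : V → ℤ) (u : E → ℚ) (hu0 : ∀ e, 0 ≤ u e)
    (hu : incidenceMap s t u = fun v => (θ v : ℚ)) :
    u ∈ convexHull ℚ {x : E → ℚ | ∃ k : E → ℕ, x = (fun e => (k e : ℚ)) ∧
      incidenceMap s t x = fun v => (θ v : ℚ)} := by
  induction hF : fracSupport u using Finset.strongInduction generalizing u with
  | H F ih =>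
    subst hF
    rcases (fracSupport u).eq_empty_or_nonempty with hempty | hne
    · refine subset_convexHull ℚ _ ⟨fun e => ⌊u e⌋₊, ?_, hu⟩
      ext e
      have h0 : Int.fract (u e) = 0 := by
        by_contra h
        simpa [hempty] using mem_fracSupport.2 h
      rw [natCast_floor_eq_intCast_floor (hu0 e)]
      linarith [Int.floor_add_fract (u e)]
    · obtain ⟨w, hw, hsupp, hBw⟩ :=
        exists_circulation_of_fracSupport_nonempty s t (fun v => congrFun hu v) hne
      have key : ∀ w : E → ℚ, w ≠ 0 → (∀ e, w e ≠ 0 → e ∈ fracSupport u) →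
          incidenceMap s t w = 0 → ∃ c : ℚ, 0 < c ∧ u + c • w ∈ convexHull ℚ
            {x : E → ℚ | ∃ k : E → ℕ, x = (fun e => (k e : ℚ)) ∧
              incidenceMap s t x = fun v => (θ v : ℚ)} := by
        intro w hw hsupp hBw
        obtain ⟨c, hc, hfloor, hss⟩ := exists_pos_fracSupport_add_smul_ssubset hw hsupp
        refine ⟨c, hc, ih _ hss _ (fun e => le_trans ?_ (hfloor e)) ?_ rfl⟩
        · exact_mod_cast Int.floor_nonneg.2 (hu0 e)
        · rw [map_add, map_smul, hBw, smul_zero, add_zero, hu]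
      obtain ⟨a, ha, hau⟩ := key w hw hsupp hBw
      obtain ⟨b, hb, hbu⟩ := key (-w) (neg_ne_zero.2 hw)
        (fun e he => hsupp e (by simpa using he)) (by rw [map_neg, hBw, neg_zero])
      have hab : 0 < a + b := add_pos ha hb
      have := (convex_convexHull ℚ _) hau hbu (div_pos hb hab).le (div_pos ha hab).le
        (by field_simp; ring)
      convert this using 1
      ext e
      simp only [Pi.add_apply, Pi.smul_apply, Pi.neg_apply, smul_eq_mul]
      field_simp
      ring

/-!
Statement 8: For every `θ ∈ ℤ^A` with `∑ ρ, θ ρ = 0`, the convex hull in `ℚ^n`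
of `{ D(u) : u ∈ ℕ^{A×n}, B(u) = θ }` equals
`{ D(u) : u ∈ ℚ^{A×n}, u ≥ 0, B(u) = θ }`, where `B(e_i^ρ) = e_ρ − e_{ρ+g i}`
and `D(e_i^ρ) = e_i` (so `D(u)_i = ∑_ρ u_i^ρ`).
-/
theorem mckay_Ptheta_convex_hull_eq
    {A : Type*} [AddCommGroup A] [Fintype A] [DecidableEq A] {n : ℕ}
    (hn : 1 ≤ n) (g : Fin n → A)
    (hgen : AddSubgroup.closure (Set.range g) = ⊤)
    (θ : A → ℤ) (hθ : ∑ ρ : A, θ ρ = 0) :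
    convexHull ℚ
        {y : Fin n → ℚ | ∃ u : A × Fin n → ℕ,
          (∑ p : A × Fin n, (u p : ℚ) •
              (Pi.single p.1 (1 : ℚ) - Pi.single (p.1 + g p.2) 1 : A → ℚ))
            = (fun ρ => (θ ρ : ℚ)) ∧
          y = fun i => ∑ ρ : A, (u (ρ, i) : ℚ)}
      = {y : Fin n → ℚ | ∃ u : A × Fin n → ℚ, (∀ p, 0 ≤ u p) ∧
          (∑ p : A × Fin n, u p •
              (Pi.single p.1 (1 : ℚ) - Pi.single (p.1 + g p.2) 1 : A → ℚ))
            = (fun ρ => (θ ρ : ℚ)) ∧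
          y = fun i => ∑ ρ : A, u (ρ, i)} := by
  let src : A × Fin n → A := fun p => p.1
  let tgt : A × Fin n → A := fun p => p.1 + g p.2
  let D : (A × Fin n → ℚ) →ₗ[ℚ] (Fin n → ℚ) :=
    LinearMap.pi fun i => ∑ ρ : A, LinearMap.proj (ρ, i)
  have hD : ∀ u, D u = fun i => ∑ ρ : A, u (ρ, i) := fun u => by
    ext i
    simp [D]
  have hB : ∀ u : A × Fin n → ℚ, (∑ p : A × Fin n, u p •
      (Pi.single p.1 (1 : ℚ) - Pi.single (p.1 + g p.2) 1 : A → ℚ)) = incidenceMap src tgt u :=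
    fun u => rfl
  simp_rw [hB]
  apply Set.Subset.antisymm
  · apply convexHull_min
    · rintro y ⟨u, hu, rfl⟩
      exact ⟨fun p => u p, fun p => Nat.cast_nonneg _, (hB fun p => (u p : ℚ)).symm.trans hu, rfl⟩
    · rintro _ ⟨u, hu0, hu, rfl⟩ _ ⟨v, hv0, hv, rfl⟩ a b ha hb hab
      refine ⟨a • u + b • v, fun p => ?_, ?_, ?_⟩
      · exact add_nonneg (mul_nonneg ha (hu0 p)) (mul_nonneg hb (hv0 p))
      · rw [map_add, map_smul, map_smul, hu, hv, ← add_smul, hab, one_smul]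
      · rw [← hD, ← hD, ← hD, map_add, map_smul, map_smul]
  · rintro _ ⟨u, hu0, hu, rfl⟩
    have h := Set.mem_image_of_mem D (mem_convexHull_natFlows src tgt θ u hu0 hu)
    rw [D.image_convexHull, hD] at h
    refine convexHull_mono ?_ h
    rintro _ ⟨x, ⟨k, rfl, hk⟩, rfl⟩
    exact ⟨k, hk, hD _⟩
end

section
/- Let θ ∈ ℚ^A satisfy Σ_{ρ ∈ A} θ_ρ = 0, and set P_θ := { D(u) : u ∈ ℚ^{A×n}, u ≥ 0 componentwise, B(u) = θ } ⊆ ℚ^n. Then P_θ is nonempty, and for w ∈ ℚ^n the linear functional y ↦ Σ_{i=1}^n w_i y_i is bounded below on P_θ if and only if w_i ≥ 0 for all i. (This expresses that the support of the inner normal fan of P_θ is the cone (ℚ^n_{≥0})^∨.) -/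
/-- The cone spanned by the vectors `e_ρ - e_{ρ + g i}`, that is, the nonnegative combinations of
the columns of the incidence matrix of the McKay quiver. -/
def mckayCone {A : Type*} [AddCommGroup A] [Fintype A] [DecidableEq A] {n : ℕ}
    (g : Fin n → A) : AddSubmonoid (A → ℚ) where
  carrier := {x | ∃ u : A × Fin n → ℚ, (∀ p, 0 ≤ u p) ∧
    (∑ p : A × Fin n, u p •
      (Pi.single p.1 (1 : ℚ) - Pi.single (p.1 + g p.2) 1 : A → ℚ)) = x}
  zero_mem' := ⟨0, fun _ => le_rfl, by simp⟩
  add_mem' := by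
    rintro _ _ ⟨u, hu, rfl⟩ ⟨v, hv, rfl⟩
    exact ⟨u + v, fun p => add_nonneg (hu p) (hv p), by
      simp only [Pi.add_apply, add_smul, Finset.sum_add_distrib]⟩

section

variable {A : Type*} [AddCommGroup A] [Fintype A] [DecidableEq A] {n : ℕ} {g : Fin n → A}

lemma smul_mem_mckayCone {x : A → ℚ} (hx : x ∈ mckayCone g) {c : ℚ} (hc : 0 ≤ c) :
    c • x ∈ mckayCone g := by
  obtain ⟨u, hu, rfl⟩ := hx
  exact ⟨c • u, fun p => mul_nonneg hc (hu p), by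
    simp only [Pi.smul_apply, smul_assoc, Finset.smul_sum]⟩

lemma single_sub_single_add_generator_mem_mckayCone (ρ : A) (i : Fin n) :
    (Pi.single ρ (1 : ℚ) - Pi.single (ρ + g i) 1 : A → ℚ) ∈ mckayCone g := by
  refine ⟨Pi.single (ρ, i) 1, fun p => ?_, ?_⟩
  · rw [Pi.single_apply]
    split_ifs <;> norm_num
  · rw [Finset.sum_eq_single (ρ, i)]
    · simp
    · intro p _ hp
      simp [Pi.single_eq_of_ne hp]
    · simp

lemma single_sub_single_add_mem_mckayCone
    (hgen : AddSubgroup.closure (Set.range g) = ⊤) (a ρ : A) :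
    (Pi.single ρ (1 : ℚ) - Pi.single (ρ + a) 1 : A → ℚ) ∈ mckayCone g := by
  have h_add : ∀ x y : A,
      (∀ ρ, (Pi.single ρ (1 : ℚ) - Pi.single (ρ + x) 1 : A → ℚ) ∈ mckayCone g) →
      (∀ ρ, (Pi.single ρ (1 : ℚ) - Pi.single (ρ + y) 1 : A → ℚ) ∈ mckayCone g) →
      ∀ ρ, (Pi.single ρ (1 : ℚ) - Pi.single (ρ + (x + y)) 1 : A → ℚ) ∈ mckayCone g := by
    intro x y hx hy ρ
    have h := add_mem (hx ρ) (hy (ρ + x))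
    rwa [sub_add_sub_cancel, add_assoc] at h
  have h_zero : ∀ ρ, (Pi.single ρ (1 : ℚ) - Pi.single (ρ + 0) 1 : A → ℚ) ∈ mckayCone g := by
    intro ρ
    rw [add_zero, sub_self]
    exact zero_mem _
  have ha : a ∈ AddSubgroup.closure (Set.range g) := hgen ▸ AddSubgroup.mem_top a
  induction ha using AddSubgroup.closure_induction generalizing ρ with
  | mem x hx =>
    obtain ⟨i, rfl⟩ := hx
    exact single_sub_single_add_generator_mem_mckayCone ρ i
  | zero => exact h_zero ρ
  | add x y _ _ hx hy => exact h_add x y hx hy ρ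
  | neg x _ hx =>
    have h_nsmul : ∀ k : ℕ, ∀ ρ,
        (Pi.single ρ (1 : ℚ) - Pi.single (ρ + k • x) 1 : A → ℚ) ∈ mckayCone g := by
      intro k
      induction k with
      | zero => simpa only [zero_smul] using h_zero
      | succ k ih => simpa only [succ_nsmul] using h_add _ _ ih hx
    have h_neg : (Fintype.card A - 1) • x = -x := by
      rw [eq_neg_iff_add_eq_zero, ← succ_nsmul, Nat.sub_add_cancel Fintype.card_pos,
        card_nsmul_eq_zero]
    exact h_neg ▸ h_nsmul _ ρ

lemma mem_mckayCone_of_sum_eq_zero (hgen : AddSubgroup.closure (Set.range g) = ⊤)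
    {θ : A → ℚ} (hθ : ∑ ρ : A, θ ρ = 0) : θ ∈ mckayCone g := by
  have h_decomp : θ = ∑ ρ : A, θ ρ • (Pi.single ρ (1 : ℚ) - Pi.single 0 1 : A → ℚ) := by
    simp only [smul_sub, Finset.sum_sub_distrib, ← Finset.sum_smul, hθ, zero_smul, sub_zero]
    exact pi_eq_sum_univ' θ |>.trans (by simp)
  rw [h_decomp]
  refine sum_mem fun ρ _ => ?_
  rcases le_total 0 (θ ρ) with h | h
  · have h_mem := single_sub_single_add_mem_mckayCone hgen (-ρ) ρ
    rw [add_neg_cancel] at h_mem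
    exact smul_mem_mckayCone h_mem h
  · have h_mem := single_sub_single_add_mem_mckayCone hgen ρ 0
    rw [zero_add] at h_mem
    rw [← neg_smul_neg, neg_sub]
    exact smul_mem_mckayCone h_mem (neg_nonneg.2 h)

/-- The sum of all arrows of a given type lies in the kernel of the incidence map. -/
lemma sum_ite_smul_single_sub_single_add (g : Fin n → A) (i : Fin n) (t : ℚ) :
    ∑ p : A × Fin n, (if p.2 = i then t else 0) •
      (Pi.single p.1 (1 : ℚ) - Pi.single (p.1 + g p.2) 1 : A → ℚ) = 0 := by
  simp only [Fintype.sum_prod_type, ite_smul, zero_smul, Finset.sum_ite_eq', Finset.mem_univ,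
    if_true, ← Finset.smul_sum, Finset.sum_sub_distrib]
  have h_shift := Equiv.sum_comp (Equiv.addRight (g i)) fun ρ : A => (Pi.single ρ (1 : ℚ) : A → ℚ)
  simp only [Equiv.coe_addRight] at h_shift
  rw [h_shift, sub_self, smul_zero]

end


/-!
Statement 9: For `θ ∈ ℚ^A` with `∑ ρ, θ ρ = 0`, the polyhedron
`P_θ = { D(u) : u ∈ ℚ^{A×n}, u ≥ 0, B(u) = θ } ⊆ ℚ^n` is nonempty, and for
`w ∈ ℚ^n` the linear functional `y ↦ ∑ i, w i * y i` is bounded below on `P_θ`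
if and only if `w i ≥ 0` for all `i`.
-/
theorem mckay_Ptheta_nonempty_and_recession
    {A : Type*} [AddCommGroup A] [Fintype A] [DecidableEq A] {n : ℕ}
    (hn : 1 ≤ n) (g : Fin n → A)
    (hgen : AddSubgroup.closure (Set.range g) = ⊤)
    (θ : A → ℚ) (hθ : ∑ ρ : A, θ ρ = 0) :
    let P : Set (Fin n → ℚ) :=
      {y | ∃ u : A × Fin n → ℚ, (∀ p, 0 ≤ u p) ∧
        (∑ p : A × Fin n, u p •
            (Pi.single p.1 (1 : ℚ) - Pi.single (p.1 + g p.2) 1 : A → ℚ)) = θ ∧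
        y = fun i => ∑ ρ : A, u (ρ, i)}
    P.Nonempty ∧
      ∀ w : Fin n → ℚ,
        (∃ c : ℚ, ∀ y ∈ P, c ≤ ∑ i, w i * y i) ↔ ∀ i, 0 ≤ w i := by
  intro P
  obtain ⟨u, hu, hB⟩ := mem_mckayCone_of_sum_eq_zero hgen hθ
  refine ⟨⟨_, u, hu, hB, rfl⟩, fun w => ⟨?_, ?_⟩⟩
  · rintro ⟨c, hc⟩ i
    by_contra! hw
    have h_bound : ∀ t : ℚ, 0 ≤ t →
        c ≤ ∑ j, w j * ∑ ρ : A, u (ρ, j) + w i * (Fintype.card A * t) := by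
      intro t ht
      refine (hc _ ⟨fun p => u p + if p.2 = i then t else 0, fun p => ?_, ?_, rfl⟩).trans_eq ?_
      · exact add_nonneg (hu p) (ite_nonneg ht le_rfl)
      · simp only [add_smul, Finset.sum_add_distrib, hB, sum_ite_smul_single_sub_single_add,
          add_zero]
      · have h_ite : ∀ j, w j * ∑ _ρ : A, (if j = i then t else 0)
            = if j = i then w i * (Fintype.card A * t) else 0 := by
          intro j
          split_ifs with h
          · simp [h]
          · simp
        simp only [Finset.sum_add_distrib, mul_add, h_ite, Finset.sum_ite_eq', Finset.mem_univ,
          if_true]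
    have h_zero := h_bound 0 le_rfl
    set S := ∑ j, w j * ∑ ρ : A, u (ρ, j)
    have h_card : (0 : ℚ) < Fintype.card A := by exact_mod_cast Fintype.card_pos
    have h_lt := h_bound ((S - c + 1) / (-w i * Fintype.card A))
      (div_nonneg (by linarith) (mul_nonneg (by linarith) h_card.le))
    have h_eq : w i * (Fintype.card A * ((S - c + 1) / (-w i * Fintype.card A)))
        = -(S - c + 1) := by
      field_simp [hw.ne, h_card.ne']
    linarith
  · rintro hw
    refine ⟨0, ?_⟩
    rintro _ ⟨v, hv, -, rfl⟩
    exact Finset.sum_nonneg fun i _ => mul_nonneg (hw i) (Finset.sum_nonneg fun ρ _ => hv _)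
end

section
/- Let r ≥ 1, let A = ℤ/rℤ, and take g_i = 1 + rℤ for all 1 ≤ i ≤ n (the weight (1,…,1) action of ℤ/rℤ). Let θ ∈ ℚ^A satisfy Σ_{ρ ∈ A} θ_ρ = 0. Then the minimum d_θ := min { Σ_{ρ,i} u_i^ρ : u ∈ ℚ^{A×n}, u ≥ 0 componentwise, B(u) = θ } exists (and d_θ ∈ ℕ when θ is integral), and { D(u) : u ∈ ℚ^{A×n}, u ≥ 0 componentwise, B(u) = θ } = { y ∈ ℚ^n : y_i ≥ 0 for all i, and Σ_{i=1}^n y_i ≥ d_θ }. -/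
/-- Summing over `ZMod r` is summing over the representatives `0, …, r - 1`. -/
theorem ZMod.sum_range_natCast {M : Type*} [AddCommMonoid M] (r : ℕ) [NeZero r] (f : ZMod r → M) :
    ∑ j ∈ Finset.range r, f (j : ZMod r) = ∑ x, f x := by
  refine Finset.sum_bij' (fun j _ => (j : ZMod r)) (fun x _ => x.val) ?_ ?_ ?_ ?_ ?_
  · simp
  · intro x _
    simpa using ZMod.val_lt x
  · intro j hj
    exact ZMod.val_cast_of_lt (Finset.mem_range.mp hj)
  · simp
  · simp

/-- A function on `ZMod r` with zero sum has a discrete primitive, with values in any subgroup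
containing the values of the function. -/
theorem ZMod.exists_primitive {M : Type*} [AddCommGroup M] (r : ℕ) [NeZero r] (θ : ZMod r → M)
    (hθ : ∑ x, θ x = 0) :
    ∃ w : ZMod r → M, (∀ x, w x - w (x - 1) = θ x) ∧
      ∀ S : AddSubgroup M, (∀ x, θ x ∈ S) → ∀ x, w x ∈ S := by
  set W : ℕ → M := fun k => ∑ j ∈ Finset.range k, θ (j : ZMod r) with hW
  have hper : Function.Periodic W r := by
    intro k
    have h : ∑ j ∈ Finset.range r, θ ((k : ZMod r) + (j : ZMod r)) = 0 := by
      rw [ZMod.sum_range_natCast r (fun x => θ (k + x)), ← hθ]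
      exact Equiv.sum_comp (Equiv.addLeft (k : ZMod r)) θ
    simp only [hW, Finset.sum_range_add, Nat.cast_add, h, add_zero]
  have hval (x : ZMod r) : W (x + 1).val = W (x.val + 1) := by
    rw [ZMod.val_add, ZMod.val_one_eq_one_mod, Nat.add_mod_mod, hper.map_mod_nat]
  refine ⟨fun x => W (x + 1).val, fun x => ?_, fun S hS x => S.sum_mem fun j _ => hS _⟩
  beta_reduce
  rw [sub_add_cancel, hval, sub_eq_iff_eq_add']
  simp [hW, Finset.sum_range_succ]

/-- The primitive can be normalized to have minimum `0`. -/
theorem ZMod.exists_primitive_nonneg (r : ℕ) [NeZero r] (θ : ZMod r → ℚ)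
    (hθ : ∑ x, θ x = 0) :
    ∃ v : ZMod r → ℚ, (∀ x, v x - v (x - 1) = θ x) ∧ (∀ x, 0 ≤ v x) ∧ (∃ x, v x = 0) ∧
      ∀ S : AddSubgroup ℚ, (∀ x, θ x ∈ S) → ∀ x, v x ∈ S := by
  obtain ⟨w, hw, hS⟩ := ZMod.exists_primitive r θ hθ
  obtain ⟨m, hm⟩ := Finite.exists_min w
  exact ⟨fun x => w x - w m, fun x => by rw [← hw x]; ring, fun x => sub_nonneg.mpr (hm x),
    ⟨m, sub_self _⟩, fun S h x => S.sub_mem (hS S h x) (hS S h m)⟩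

/-- A function on `ZMod r` invariant under translation by `1` is constant. -/
theorem ZMod.eq_of_sub_one_invariant {M : Type*} (r : ℕ) [NeZero r] (f : ZMod r → M)
    (hf : ∀ x, f x = f (x - 1)) (x y : ZMod r) : f x = f y := by
  have key (k : ℕ) : f (k : ZMod r) = f 0 := by
    induction k with
    | zero => simp
    | succ k ih => rw [hf, ← ih]; simp
  have hx := key x.val
  have hy := key y.val
  rw [ZMod.natCast_zmod_val] at hx hy
  rw [hx, hy]

/-- The incidence map of the weight `(1, …, 1)` McKay quiver takes the value `θ` at `u` exactly when
the sums of `u` over the arrows leaving each vertex form a discrete primitive of `θ`. -/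
theorem mckay_weight_one_incidence_eq_iff (r : ℕ) [NeZero r] {n : ℕ} (θ : ZMod r → ℚ)
    (u : ZMod r × Fin n → ℚ) :
    (∑ p : ZMod r × Fin n, u p •
        (Pi.single p.1 (1 : ℚ) - Pi.single (p.1 + 1) 1 : ZMod r → ℚ)) = θ ↔
      ∀ x, ∑ i, u (x, i) - ∑ i, u (x - 1, i) = θ x := by
  rw [funext_iff]
  refine forall_congr' fun x => ?_
  have h (y : ZMod r) : x = y + 1 ↔ x - 1 = y := sub_eq_iff_eq_add.symm
  simp [Finset.sum_apply, Fintype.sum_prod_type_right, Pi.single_apply, mul_sub, h]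

/-!
Statement 10: For the weight `(1,…,1)` action of `ℤ/rℤ` (`r ≥ 1`, i.e. `NeZero r`;
`g i = 1` for all `i`), and any `θ ∈ ℚ^{ℤ/rℤ}` with `∑ ρ, θ ρ = 0`:
the minimum `d_θ = min { ∑_{ρ,i} u_i^ρ : u ≥ 0, B(u) = θ }` exists, `d_θ ∈ ℕ`
whenever `θ` is integral, and
`{ D(u) : u ≥ 0, B(u) = θ } = { y ∈ ℚ^n : y ≥ 0, ∑ i, y i ≥ d_θ }`.
-/
theorem mckay_weight_one_Ptheta
    (r : ℕ) [NeZero r] {n : ℕ} (hn : 1 ≤ n)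
    (θ : ZMod r → ℚ) (hθ : ∑ ρ : ZMod r, θ ρ = 0) :
    ∃ d : ℚ,
      IsLeast {t : ℚ | ∃ u : ZMod r × Fin n → ℚ, (∀ p, 0 ≤ u p) ∧
          (∑ p : ZMod r × Fin n, u p •
              (Pi.single p.1 (1 : ℚ) - Pi.single (p.1 + 1) 1 : ZMod r → ℚ)) = θ ∧
          t = ∑ p : ZMod r × Fin n, u p} d ∧
      ((∀ ρ, ∃ z : ℤ, θ ρ = (z : ℚ)) → ∃ m : ℕ, d = (m : ℚ)) ∧
      {y : Fin n → ℚ | ∃ u : ZMod r × Fin n → ℚ, (∀ p, 0 ≤ u p) ∧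
          (∑ p : ZMod r × Fin n, u p •
              (Pi.single p.1 (1 : ℚ) - Pi.single (p.1 + 1) 1 : ZMod r → ℚ)) = θ ∧
          y = fun i => ∑ ρ : ZMod r, u (ρ, i)}
        = {y : Fin n → ℚ | (∀ i, 0 ≤ y i) ∧ d ≤ ∑ i, y i} := by
  obtain ⟨v, hv, hv0, ⟨m, hm⟩, hS⟩ := ZMod.exists_primitive_nonneg r θ hθ
  simp only [mckay_weight_one_incidence_eq_iff]
  have lower (u : ZMod r × Fin n → ℚ) (hu : ∀ p, 0 ≤ u p)
      (hB : ∀ x, ∑ i, u (x, i) - ∑ i, u (x - 1, i) = θ x) :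
      ∑ x, v x ≤ ∑ p, u p := by
    rw [Fintype.sum_prod_type]
    refine Finset.sum_le_sum fun x _ => ?_
    have h := ZMod.eq_of_sub_one_invariant r (fun x => ∑ i, u (x, i) - v x)
      (fun x => by linarith [hB x, hv x]) x m
    have hnn : 0 ≤ ∑ i, u (m, i) := Finset.sum_nonneg fun i _ => hu _
    simp only [hm] at h
    linarith
  have attained (y : Fin n → ℚ) (hy : ∀ i, 0 ≤ y i) (hd : ∑ x, v x ≤ ∑ i, y i) :
      ∃ u : ZMod r × Fin n → ℚ, (∀ p, 0 ≤ u p) ∧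
        (∀ x, ∑ i, u (x, i) - ∑ i, u (x - 1, i) = θ x) ∧
        y = fun i => ∑ ρ : ZMod r, u (ρ, i) := by
    set s := ∑ i, y i with hs
    have hs0 : 0 ≤ s := Finset.sum_nonneg fun i _ => hy i
    have hr : (0 : ℚ) < r := by exact_mod_cast Nat.pos_of_neZero r
    set c := (s - ∑ x, v x) / r with hc
    have hc0 : 0 ≤ c := div_nonneg (sub_nonneg.mpr hd) hr.le
    have hsum : ∑ x, (v x + c) = s := by
      rw [Finset.sum_add_distrib, Finset.sum_const, Finset.card_univ, ZMod.card, nsmul_eq_mul, hc]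
      field_simp
      ring
    have hvc (x : ZMod r) : 0 ≤ v x + c := add_nonneg (hv0 x) hc0
    have hcancel (a : ℚ) (ha : s = 0 → a = 0) : a * s / s = a := by
      by_cases h : s = 0
      · simp [ha h]
      · field_simp
    have hrow (x : ZMod r) : ∑ i, (v x + c) * y i / s = v x + c := by
      rw [← Finset.sum_div, ← Finset.mul_sum, ← hs]
      refine hcancel _ fun h => ?_
      rw [h] at hsum
      exact (Finset.sum_eq_zero_iff_of_nonneg fun x _ => hvc x).mp hsum x (Finset.mem_univ x)
    refine ⟨fun p => (v p.1 + c) * y p.2 / s,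
      fun p => div_nonneg (mul_nonneg (hvc _) (hy _)) hs0, fun x => ?_, funext fun i => ?_⟩
    · simp only [hrow, ← hv x]
      ring
    · simp only
      rw [← Finset.sum_div, ← Finset.sum_mul, hsum, mul_comm]
      exact (hcancel _ fun h =>
        (Finset.sum_eq_zero_iff_of_nonneg fun i _ => hy i).mp h i (Finset.mem_univ i)).symm
  have hd0 : 0 ≤ ∑ x, v x := Finset.sum_nonneg fun x _ => hv0 x
  refine ⟨∑ x, v x, ⟨?_, ?_⟩, fun hint => ?_, Set.ext fun y => ⟨?_, ?_⟩⟩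
  · have hsingle : ∑ i, (Pi.single ⟨0, hn⟩ (∑ x, v x) : Fin n → ℚ) i = ∑ x, v x := by simp
    obtain ⟨u, hu, hB, hy⟩ := attained (Pi.single ⟨0, hn⟩ (∑ x, v x))
      (Pi.single_nonneg.mpr hd0) hsingle.ge
    refine ⟨u, hu, hB, ?_⟩
    rw [Fintype.sum_prod_type_right, ← hsingle, hy]
  · rintro t ⟨u, hu, hB, rfl⟩
    exact lower u hu hB
  · have hmem : ∑ x, v x ∈ (Int.castAddHom ℚ).range :=
      sum_mem fun x _ => hS _ (fun ρ => (hint ρ).imp fun _ h => h.symm) x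
    obtain ⟨z, hz⟩ := hmem
    rw [Int.coe_castAddHom] at hz
    rw [← hz] at hd0 ⊢
    lift z to ℕ using Int.cast_nonneg_iff.mp hd0
    exact ⟨z, Int.cast_natCast z⟩
  · rintro ⟨u, hu, hB, rfl⟩
    refine ⟨fun i => Finset.sum_nonneg fun ρ _ => hu _, ?_⟩
    rw [← Fintype.sum_prod_type_right]
    exact lower u hu hB
  · rintro ⟨hy, hd⟩
    exact attained y hy hd
end
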